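/- arXiv:1706.06310 — 2 statements merged into one kernel-verified Lean document; each statement's English description precedes it below -/
import Mathlib

section
/- Let n ≥ 2 and let p satisfy 2 − n < p < 1. Then there exist K ∈ K_0^n, a continuous function f : S^{n-1} → ℝ with f(u) > 0 for all u ∈ S^{n-1}, and u₀ ∈ S^{n-1} such that K is a solution of the L_p Minkowski problem dS_{K,p} = f dH^{n-1}, the face F(K,u₀) has affine hull of dimension n − 1, and the origin o lies in the relative interior of F(K,u₀) (the interior of F(K,u₀) relative to its affine hull). -/
open MeasureTheory Set
open scoped ENNReal NNReal RealInnerProductSpace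

noncomputable section

/-- Support function of a set `K`. -/
def suppFn {n : ℕ} (K : Set (EuclideanSpace ℝ (Fin n))) (u : EuclideanSpace ℝ (Fin n)) : ℝ :=
  sSup ((fun y => ⟪u, y⟫) '' K)

/-- Face of `K` with outer normal `u`. -/
def face {n : ℕ} (K : Set (EuclideanSpace ℝ (Fin n))) (u : EuclideanSpace ℝ (Fin n)) :
    Set (EuclideanSpace ℝ (Fin n)) :=
  {z ∈ K | ⟪z, u⟫ = suppFn K u}

/-- Normal cone of `K` at `z`. -/
def normalCone {n : ℕ} (K : Set (EuclideanSpace ℝ (Fin n))) (z : EuclideanSpace ℝ (Fin n)) :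
    Set (EuclideanSpace ℝ (Fin n)) :=
  {u | ∀ y ∈ K, ⟪u, y⟫ ≤ ⟪u, z⟫}

/-- The unit sphere `S^{n-1}` in `ℝ^n`. -/
def unitSphere (n : ℕ) : Set (EuclideanSpace ℝ (Fin n)) :=
  Metric.sphere (0 : EuclideanSpace ℝ (Fin n)) 1

/-- Surface area measure of `K` evaluated on `ω`:
`S_K(ω) = H^{n-1}(⋃_{u ∈ ω} F(K,u))`. -/
def surfMeas {n : ℕ} (K : Set (EuclideanSpace ℝ (Fin n)))
    (ω : Set (EuclideanSpace ℝ (Fin n))) : ℝ≥0∞ :=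
  μH[(n : ℝ) - 1] (⋃ u ∈ ω, face K u)

/-- `K ∈ 𝒦₀ⁿ`: compact convex with nonempty interior, containing the origin. -/
def IsConvexBody0 {n : ℕ} (K : Set (EuclideanSpace ℝ (Fin n))) : Prop :=
  IsCompact K ∧ Convex ℝ K ∧ (interior K).Nonempty ∧ (0 : EuclideanSpace ℝ (Fin n)) ∈ K

/-- `K` is a solution of the `L_p` Minkowski problem `dS_{K,p} = f dH^{n-1}`. -/
def IsLpSolution {n : ℕ} (p : ℝ) (f : EuclideanSpace ℝ (Fin n) → ℝ)
    (K : Set (EuclideanSpace ℝ (Fin n))) : Prop :=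
  μH[(n : ℝ) - 1] {u ∈ unitSphere n | suppFn K u = 0} = 0 ∧
  ∀ ω : Set (EuclideanSpace ℝ (Fin n)), MeasurableSet ω →
    ω ⊆ {u ∈ unitSphere n | 0 < suppFn K u} →
    surfMeas K ω
      = ∫⁻ u in ω, ENNReal.ofReal ((n : ℝ) * f u * suppFn K u ^ (p - 1)) ∂μH[(n : ℝ) - 1]

/-- `x` is a smooth boundary point: the normal cone spans a one-dimensional space. -/
def IsSmoothPt {n : ℕ} (K : Set (EuclideanSpace ℝ (Fin n)))
    (x : EuclideanSpace ℝ (Fin n)) : Prop :=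
  Module.finrank ℝ (Submodule.span ℝ (normalCone K x)) = 1

/-- `K` is smooth: every boundary point is a smooth point. -/
def IsSmoothBody {n : ℕ} (K : Set (EuclideanSpace ℝ (Fin n))) : Prop :=
  ∀ x ∈ frontier K, IsSmoothPt K x

/-- Subgradient of `v` at `x` relative to the domain `Ω`. -/
def subgrad {n : ℕ} (Ω : Set (EuclideanSpace ℝ (Fin n))) (v : EuclideanSpace ℝ (Fin n) → ℝ)
    (x : EuclideanSpace ℝ (Fin n)) : Set (EuclideanSpace ℝ (Fin n)) :=
  {z | ∀ y ∈ Ω, v x + ⟪z, y - x⟫ ≤ v y}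

/-- Monge–Ampère measure of `v` (relative to domain `Ω`) evaluated on `ω`. -/
def maMeasure {n : ℕ} (Ω : Set (EuclideanSpace ℝ (Fin n))) (v : EuclideanSpace ℝ (Fin n) → ℝ)
    (ω : Set (EuclideanSpace ℝ (Fin n))) : ℝ≥0∞ :=
  μH[(n : ℝ)] (⋃ x ∈ ω, subgrad Ω v x)

/-- Hessian matrix of `v : ℝ^n → ℝ` at `x`. -/
def hessMatrix {n : ℕ} (v : EuclideanSpace ℝ (Fin n) → ℝ) (x : EuclideanSpace ℝ (Fin n)) :
    Matrix (Fin n) (Fin n) ℝ :=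
  Matrix.of fun i j =>
    fderiv ℝ (fun y => fderiv ℝ v y (EuclideanSpace.single j 1)) x (EuclideanSpace.single i 1)

lemma aux_cmp {X Y Z : Type*} [Nonempty X] [MetricSpace Y] [MetricSpace Z]
    [MeasurableSpace Y] [BorelSpace Y] [MeasurableSpace Z] [BorelSpace Z]
    (g₁ : X → Y) (g₂ : X → Z) (A : Set X) (C : ℝ≥0) {d : ℝ} (hd : 0 ≤ d)
    (h : ∀ x ∈ A, ∀ y ∈ A, dist (g₁ x) (g₁ y) ≤ C * dist (g₂ x) (g₂ y)) :
    μH[d] (g₁ '' A) ≤ (C : ℝ≥0∞) ^ d * μH[d] (g₂ '' A) := by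
  classical
  let r : Z → X := Function.invFunOn g₂ A
  have hr : ∀ x ∈ A, r (g₂ x) ∈ A ∧ g₂ (r (g₂ x)) = g₂ x := fun x hx =>
    ⟨Function.invFunOn_mem ⟨x, hx, rfl⟩, Function.invFunOn_eq ⟨x, hx, rfl⟩⟩
  have hl : LipschitzOnWith C (g₁ ∘ r) (g₂ '' A) := by
    apply LipschitzOnWith.of_dist_le_mul
    rintro _ ⟨x, hx, rfl⟩ _ ⟨y, hy, rfl⟩
    have := h _ (hr x hx).1 _ (hr y hy).1
    rwa [(hr x hx).2, (hr y hy).2] at this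
  have himg : (g₁ ∘ r) '' (g₂ '' A) = g₁ '' A := by
    have key : ∀ x ∈ A, g₁ (r (g₂ x)) = g₁ x := by
      intro x hx
      have := h _ (hr x hx).1 _ hx
      rw [(hr x hx).2, dist_self, mul_zero] at this
      exact dist_le_zero.1 this
    ext y
    constructor
    · rintro ⟨_, ⟨x, hx, rfl⟩, rfl⟩
      exact ⟨x, hx, (key x hx).symm⟩
    · rintro ⟨x, hx, rfl⟩
      exact ⟨_, ⟨x, hx, rfl⟩, key x hx⟩
  rw [← himg]
  exact hl.hausdorffMeasure_image_le hd

lemma aux_density {F : Type*} [NormedAddCommGroup F] [NormedSpace ℝ F] [FiniteDimensional ℝ F]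
    [MeasurableSpace F] [BorelSpace F] (d : ℝ) (G : F → F) (S : Set F)
    (D : F → ℝ) (hG : ContinuousOn G S) (hinj : InjOn G S)
    (hD : ContinuousOn D S) (hpos : ∀ u ∈ S, 0 < D u)
    (hloc : ∀ M : ℝ≥0, 1 < M → ∀ u ∈ S, ∃ U ∈ nhdsWithin u S, ∀ A ⊆ U, A ⊆ S →
      μH[d] (G '' A) ≤ M * (ENNReal.ofReal (D u) * μH[d] A) ∧
      ENNReal.ofReal (D u) * μH[d] A ≤ M * μH[d] (G '' A))
    (ω : Set F) (hω : MeasurableSet ω) (hωS : ω ⊆ S) :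
    μH[d] (G '' ω) = ∫⁻ u in ω, ENNReal.ofReal (D u) ∂μH[d] := by
  classical
  have : ProperSpace F := FiniteDimensional.proper ℝ F
  have main : ∀ M : ℝ≥0, 1 < M →
      μH[d] (G '' ω) ≤ (M * M : ℝ≥0) * ∫⁻ u in ω, ENNReal.ofReal (D u) ∂μH[d] ∧
      ∫⁻ u in ω, ENNReal.ofReal (D u) ∂μH[d] ≤ (M * M : ℝ≥0) * μH[d] (G '' ω) := by
    intro M hM
    have hM0 : (0:ℝ) < M := by
      have : (1:ℝ) < M := by exact_mod_cast hM
      linarith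
    have step : ∀ u ∈ S, ∃ U ∈ nhds u, ∀ A ⊆ U, A ⊆ S → MeasurableSet A →
        μH[d] (G '' A) ≤ (M * M : ℝ≥0) * ∫⁻ u in A, ENNReal.ofReal (D u) ∂μH[d] ∧
        ∫⁻ u in A, ENNReal.ofReal (D u) ∂μH[d] ≤ (M * M : ℝ≥0) * μH[d] (G '' A) := by
      intro u hu
      obtain ⟨U, hU, hUA⟩ := hloc M hM u hu
      have h1 : ∀ᶠ x in nhdsWithin u S, D x < M * D u := by
        apply (hD u hu).eventually_lt_const
        have := hpos u hu
        have : (1:ℝ) < M := by exact_mod_cast hM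
        nlinarith
      have h2 : ∀ᶠ x in nhdsWithin u S, D u / M < D x := by
        apply (hD u hu).eventually_const_lt
        have := hpos u hu
        have : (1:ℝ) < M := by exact_mod_cast hM
        rw [div_lt_iff₀ hM0]
        nlinarith
      have h3 := Filter.inter_mem hU (h1.and h2)
      rw [mem_nhdsWithin_iff_exists_mem_nhds_inter] at h3
      obtain ⟨W, hW, hWS⟩ := h3
      refine ⟨W, hW, fun A hA hAS hAm => ?_⟩
      have hAU : A ⊆ U := fun x hx => (hWS ⟨hA hx, hAS hx⟩).1
      obtain ⟨k1, k2⟩ := hUA A hAU hAS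
      have k3 : ENNReal.ofReal (D u) * μH[d] A ≤ M * ∫⁻ u in A, ENNReal.ofReal (D u) ∂μH[d] := by
        rw [← setLIntegral_const, ← lintegral_const_mul' _ _ ENNReal.coe_ne_top]
        apply setLIntegral_mono' hAm
        intro x hx
        have := (hWS ⟨hA hx, hAS hx⟩).2.2
        rw [div_lt_iff₀ hM0] at this
        rw [← ENNReal.ofReal_coe_nnreal, ← ENNReal.ofReal_mul hM0.le]
        apply ENNReal.ofReal_le_ofReal
        linarith
      have k4 : ∫⁻ u in A, ENNReal.ofReal (D u) ∂μH[d] ≤ M * (ENNReal.ofReal (D u) * μH[d] A) := by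
        rw [← mul_assoc, ← setLIntegral_const]
        apply setLIntegral_mono' hAm
        intro x hx
        have := (hWS ⟨hA hx, hAS hx⟩).2.1
        rw [← ENNReal.ofReal_coe_nnreal, ← ENNReal.ofReal_mul hM0.le]
        apply ENNReal.ofReal_le_ofReal
        linarith
      constructor
      · refine k1.trans ?_
        rw [ENNReal.coe_mul, mul_assoc]
        gcongr
      · refine k4.trans ?_
        rw [ENNReal.coe_mul, mul_assoc]
        gcongr
    choose! W hW hWA using step
    -- countable cover
    have hcov : ∀ x ∈ ω, interior (W x) ∈ nhdsWithin x ω := fun x hx =>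
      mem_nhdsWithin_of_mem_nhds (interior_mem_nhds.2 (hW x (hωS hx)))
    obtain ⟨t, htω, htc, hcover⟩ := TopologicalSpace.countable_cover_nhdsWithin hcov
    rcases ω.eq_empty_or_nonempty with hω0 | hne
    · simp [hω0]
    have htne : t.Nonempty := by
      obtain ⟨x, hx⟩ := hne
      have := hcover hx
      simp only [mem_iUnion] at this
      obtain ⟨i, hi, _⟩ := this
      exact ⟨i, hi⟩
    obtain ⟨φ, hφ⟩ := htc.exists_eq_range htne
    have hφS : ∀ i, φ i ∈ S := fun i => hωS (htω (hφ ▸ mem_range_self i))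
    let P : ℕ → Set F := fun i => ω ∩ disjointed (fun i => interior (W (φ i))) i
    have hPm : ∀ i, MeasurableSet (P i) := fun i =>
      hω.inter (MeasurableSet.disjointed (fun i => isOpen_interior.measurableSet) i)
    have hPd : Pairwise (Function.onFun Disjoint P) := fun i j hij =>
      ((disjoint_disjointed (fun i => interior (W (φ i)))) hij).mono inter_subset_right inter_subset_right
    have hPS : ∀ i, P i ⊆ S := fun i => inter_subset_left.trans hωS
    have hPW : ∀ i, P i ⊆ W (φ i) := fun i =>
      inter_subset_right.trans ((disjointed_subset _ i).trans interior_subset)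
    have hPu : ω = ⋃ i, P i := by
      rw [← inter_iUnion, iUnion_disjointed]
      refine (inter_eq_left.2 ?_).symm
      intro x hx
      have := hcover hx
      rw [hφ] at this
      simpa using this
    have e1 : μH[d] (G '' ω) = ∑' i, μH[d] (G '' P i) := by
      conv_lhs => rw [hPu, image_iUnion]
      apply measure_iUnion
      · intro i j hij
        refine (hPd hij).image hinj (hPS i) (hPS j)
      · intro i
        exact (hPm i).image_of_continuousOn_injOn (hG.mono (hPS i)) (hinj.mono (hPS i))
    have e2 : ∫⁻ u in ω, ENNReal.ofReal (D u) ∂μH[d]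
        = ∑' i, ∫⁻ u in P i, ENNReal.ofReal (D u) ∂μH[d] := by
      conv_lhs => rw [hPu]
      exact lintegral_iUnion hPm hPd _
    rw [e1, e2, ← ENNReal.tsum_mul_left, ← ENNReal.tsum_mul_left]
    exact ⟨ENNReal.tsum_le_tsum fun i => (hWA _ (hφS i) _ (hPW i) (hPS i) (hPm i)).1,
      ENNReal.tsum_le_tsum fun i => (hWA _ (hφS i) _ (hPW i) (hPS i) (hPm i)).2⟩
  have lim : ∀ a b : ℝ≥0∞, (∀ M : ℝ≥0, 1 < M → a ≤ (M * M : ℝ≥0) * b) → a ≤ b := by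
    intro a b h
    rcases eq_or_ne b ⊤ with rfl | hb
    · exact le_top
    have ht : Filter.Tendsto (fun M : ℝ≥0 => ((M * M : ℝ≥0) : ℝ≥0∞) * b) (nhdsWithin 1 (Ioi 1))
        (nhds (((1 * 1 : ℝ≥0) : ℝ≥0∞) * b)) := by
      apply ENNReal.Tendsto.mul_const _ (Or.inr hb)
      apply Filter.Tendsto.mono_left _ nhdsWithin_le_nhds
      apply ENNReal.tendsto_coe.2
      exact (continuous_id.mul continuous_id).tendsto 1
    have := ge_of_tendsto ht (Filter.eventually_of_mem self_mem_nhdsWithin (fun M hM => h M hM))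
    simpa using this
  exact le_antisymm (lim _ _ fun M hM => (main M hM).1) (lim _ _ fun M hM => (main M hM).2)

lemma aux_local {F : Type*} [NormedAddCommGroup F] [InnerProductSpace ℝ F] [FiniteDimensional ℝ F]
    [MeasurableSpace F] [BorelSpace F] (u : F) (hu : ‖u‖ = 1)
    (G : F → F) (G' : F →L[ℝ] F) (hG : HasStrictFDerivAt G G' u)
    (L : (ℝ ∙ u)ᗮ →ₗ[ℝ] (ℝ ∙ u)ᗮ) (hL : LinearMap.det L ≠ 0)
    (hLG : ∀ v : (ℝ ∙ u)ᗮ, G' v = L v) (d : ℕ) (hd : Module.finrank ℝ (ℝ ∙ u)ᗮ = d)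
    (M : ℝ≥0) (hM : 1 < M) :
    ∃ U ∈ nhds u, ∀ A ⊆ U, A ⊆ Metric.sphere 0 1 →
      μH[d] (G '' A) ≤ M * (ENNReal.ofReal |LinearMap.det L| * μH[d] A) ∧
      ENNReal.ofReal |LinearMap.det L| * μH[d] A ≤ M * μH[d] (G '' A) := by
  classical
  obtain ⟨C, hC1, hCM⟩ : ∃ C : ℝ≥0, 1 < C ∧ C ^ d * C ^ d ≤ M := by
    have h1 : ∀ᶠ C : ℝ≥0 in nhdsWithin 1 (Ioi 1), C ^ d * C ^ d < M := by
      apply Filter.Eventually.filter_mono nhdsWithin_le_nhds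
      have : ContinuousAt (fun C : ℝ≥0 => C ^ d * C ^ d) 1 := by fun_prop
      apply this.eventually_lt_const
      simpa using hM
    obtain ⟨C, h2, h3⟩ := (h1.and self_mem_nhdsWithin).exists
    exact ⟨C, h3, h2.le⟩
  have hC1' : (1:ℝ) < C := by exact_mod_cast hC1
  have hC0 : (0:ℝ) < C := by linarith
  obtain ⟨κ, hκ, hanti⟩ := L.exists_antilipschitzWith (LinearMap.ker_eq_bot.2 (by
    have := (LinearMap.equivOfDetNeZero L hL).injective
    exact this))
  have hanti' : ∀ v, ‖v‖ ≤ κ * ‖L v‖ := fun v => by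
    have := hanti.le_mul_dist v 0
    simpa using this
  have hκ' : (0:ℝ) < κ := hκ
  set θ : ℝ := 1 - 1 / C with hθ
  have hθ0 : 0 < θ := by
    have : 1 / (C:ℝ) < 1 := by rw [div_lt_one hC0]; exact hC1'
    linarith
  have hθC : (1 - θ) * C = 1 := by rw [hθ]; field_simp; ring
  have hθC2 : 1 + θ ≤ C := by nlinarith [sq_nonneg ((C:ℝ) - 1)]
  set τ : ℝ := θ / (C * κ) with hτ
  have hτ0 : 0 < τ := by positivity
  have hG2 := (hasStrictFDerivAt_iff_isLittleO.1 hG).def (half_pos hτ0)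
  rw [nhds_prod_eq] at hG2
  obtain ⟨U₁, hU₁, hGU⟩ := (Filter.eventually_prod_self_iff
    (r := fun x y => ‖G x - G y - G' (x - y)‖ ≤ τ / 2 * ‖x - y‖)).1 hG2
  set δ : ℝ := min θ (τ / (2 * (‖G'‖ + 1))) with hδ
  have hδ0 : 0 < δ := lt_min hθ0 (by positivity)
  have hδG : δ * ‖G'‖ ≤ τ / 2 := by
    have h1 : δ ≤ τ / (2 * (‖G'‖ + 1)) := min_le_right _ _
    rw [le_div_iff₀ (by positivity)] at h1
    nlinarith [norm_nonneg G']
  let P : F →L[ℝ] (ℝ ∙ u)ᗮ := (ℝ ∙ u)ᗮ.orthogonalProjectionOnto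
  have hP : ∀ w : F, w = (P w : F) + ⟪u, w⟫ • u := by
    intro w
    have h1 := Submodule.starProjection_add_starProjection_orthogonal (K := ℝ ∙ u) w
    rw [Submodule.starProjection_unit_singleton ℝ hu, add_comm] at h1
    exact h1.symm
  have hP1 : ∀ w : F, ‖P w‖ ≤ ‖w‖ := fun w => by
    have := P.le_opNorm w
    have h2 : ‖P‖ ≤ 1 := Submodule.orthogonalProjectionOnto_norm_le _
    nlinarith [norm_nonneg w]
  refine ⟨U₁ ∩ Metric.ball u δ, Filter.inter_mem hU₁ (Metric.ball_mem_nhds _ hδ0), ?_⟩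
  intro A hAU hAS
  have key : ∀ x ∈ A, ∀ y ∈ A, ‖x - y‖ ≤ C * ‖P (x - y)‖ ∧
      ‖(G x - G y) - (L (P (x - y)) : F)‖ ≤ θ * ‖L (P (x - y))‖ := by
    intro x hx y hy
    have hx1 : ‖x‖ = 1 := by simpa using hAS hx
    have hy1 : ‖y‖ = 1 := by simpa using hAS hy
    have hxu : ‖x - u‖ < δ := by simpa [dist_eq_norm] using (hAU hx).2
    have hyu : ‖y - u‖ < δ := by simpa [dist_eq_norm] using (hAU hy).2
    have hin : |⟪u, x - y⟫| ≤ δ * ‖x - y‖ := by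
      have h1 : ⟪x + y, x - y⟫ = 0 := by
        rw [inner_add_left, inner_sub_right, inner_sub_right, real_inner_self_eq_norm_sq,
          real_inner_self_eq_norm_sq, hx1, hy1, real_inner_comm]
        ring
      have h2 : 2 * ⟪u, x - y⟫ = - ⟪(x - u) + (y - u), x - y⟫ := by
        have : (x - u) + (y - u) = (x + y) - (2:ℝ) • u := by module
        rw [this, inner_sub_left, h1, inner_smul_left]
        simp
      have h3 := abs_real_inner_le_norm ((x - u) + (y - u)) (x - y)
      have h4 : ‖(x - u) + (y - u)‖ ≤ 2 * δ := (norm_add_le _ _).trans (by linarith)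
      have h5 : 2 * |⟪u, x - y⟫| = |⟪(x - u) + (y - u), x - y⟫| := by
        rw [← abs_neg ⟪(x - u) + (y - u), x - y⟫, ← h2, abs_mul]; simp
      nlinarith [norm_nonneg (x - y)]
    have hPxy := hP (x - y)
    have hk1 : ‖x - y‖ ≤ C * ‖P (x - y)‖ := by
      have h1 : ‖x - y‖ ≤ ‖P (x - y)‖ + |⟪u, x - y⟫| := by
        conv_lhs => rw [hPxy]
        refine (norm_add_le _ _).trans ?_
        rw [norm_smul, hu, mul_one, Real.norm_eq_abs, Submodule.coe_norm]
      have h2 : δ ≤ θ := min_le_left _ _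
      have h3 : (1 - θ) * ‖x - y‖ ≤ ‖P (x - y)‖ := by nlinarith [norm_nonneg (x - y)]
      calc ‖x - y‖ = C * ((1 - θ) * ‖x - y‖) := by rw [← mul_assoc, mul_comm (C:ℝ), hθC, one_mul]
        _ ≤ _ := by gcongr
    refine ⟨hk1, ?_⟩
    have h1 : ‖G x - G y - G' (x - y)‖ ≤ τ / 2 * ‖x - y‖ := hGU x (hAU hx).1 y (hAU hy).1
    have h2 : G' (x - y) = (L (P (x - y)) : F) + ⟪u, x - y⟫ • G' u := by
      conv_lhs => rw [hPxy]
      rw [map_add, hLG, map_smul]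
    have h3 : ‖⟪u, x - y⟫ • G' u‖ ≤ τ / 2 * ‖x - y‖ := by
      rw [norm_smul, Real.norm_eq_abs]
      have h4 : ‖G' u‖ ≤ ‖G'‖ := by simpa [hu] using G'.le_opNorm u
      calc _ ≤ (δ * ‖x - y‖) * ‖G'‖ := by gcongr
        _ = (δ * ‖G'‖) * ‖x - y‖ := by ring
        _ ≤ _ := by gcongr
    have h4 : (G x - G y) - (L (P (x - y)) : F)
        = (G x - G y - G' (x - y)) + ⟪u, x - y⟫ • G' u := by rw [h2]; abel
    calc _ ≤ τ / 2 * ‖x - y‖ + τ / 2 * ‖x - y‖ := by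
          rw [h4]; exact (norm_add_le _ _).trans (add_le_add h1 h3)
      _ = τ * ‖x - y‖ := by ring
      _ ≤ τ * (C * (κ * ‖L (P (x - y))‖)) := by
          gcongr
          refine hk1.trans ?_
          gcongr
          exact hanti' _
      _ = _ := by rw [hτ]; field_simp
  have hd0 : (0:ℝ) ≤ d := Nat.cast_nonneg d
  have c1 : μH[(d:ℝ)] (P '' A) ≤ μH[(d:ℝ)] A := by
    have := aux_cmp P id A 1 hd0 (fun x _ y _ => by
      rw [dist_eq_norm, ← map_sub, id, id, dist_eq_norm]; simpa using hP1 (x - y))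
    simpa using this
  have c2 : μH[(d:ℝ)] A ≤ C ^ d * μH[(d:ℝ)] (P '' A) := by
    have := aux_cmp id P A C hd0 (fun x hx y hy => by
      rw [dist_eq_norm, dist_eq_norm, ← map_sub]; exact (key x hx y hy).1)
    simpa using this
  have c3 : μH[(d:ℝ)] (G '' A) ≤ C ^ d * μH[(d:ℝ)] ((fun x => L (P x)) '' A) := by
    have := aux_cmp G (fun x => L (P x)) A C hd0 (fun x hx y hy => by
      rw [dist_eq_norm, dist_eq_norm, ← map_sub, ← map_sub]
      have h1 := (key x hx y hy).2
      have h2 : ‖G x - G y‖ ≤ ‖(G x - G y) - (L (P (x - y)) : F)‖ + ‖(L (P (x - y)) : F)‖ := by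
        simpa using norm_add_le ((G x - G y) - (L (P (x - y)) : F)) (L (P (x - y)) : F)
      rw [← Submodule.coe_norm] at h2
      nlinarith [norm_nonneg (L (P (x - y)))])
    simpa using this
  have c4 : μH[(d:ℝ)] ((fun x => L (P x)) '' A) ≤ C ^ d * μH[(d:ℝ)] (G '' A) := by
    have := aux_cmp (fun x => L (P x)) G A C hd0 (fun x hx y hy => by
      rw [dist_eq_norm, dist_eq_norm, ← map_sub, ← map_sub]
      have h1 := (key x hx y hy).2
      have h2 : ‖(L (P (x - y)) : F)‖ ≤ ‖G x - G y‖ + ‖(G x - G y) - (L (P (x - y)) : F)‖ := by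
        simpa using norm_sub_le (G x - G y) ((G x - G y) - (L (P (x - y)) : F))
      rw [← Submodule.coe_norm] at h2
      have h3 : (1 - θ) * ‖L (P (x - y))‖ ≤ ‖G x - G y‖ := by linarith
      calc ‖L (P (x - y))‖ = C * ((1 - θ) * ‖L (P (x - y))‖) := by
            rw [← mul_assoc, mul_comm (C:ℝ), hθC, one_mul]
        _ ≤ _ := by gcongr)
    simpa using this
  have c5 : μH[(d:ℝ)] ((fun x => L (P x)) '' A)
      = ENNReal.ofReal |LinearMap.det L| * μH[(d:ℝ)] (P '' A) := by
    have : (fun x => L (P x)) '' A = L '' (P '' A) := by rw [image_image]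
    rw [this, ← hd]
    exact Measure.addHaar_image_linearMap _ L _
  have hCM' : (C:ℝ≥0∞) ^ d * C ^ d ≤ M := by exact_mod_cast hCM
  have hC1d : (1:ℝ≥0∞) ≤ C ^ d := one_le_pow₀ (by exact_mod_cast hC1.le)
  have hCM1 : (C:ℝ≥0∞) ^ d ≤ M := le_trans (by simpa using mul_le_mul_right hC1d (C ^ d : ℝ≥0∞)) hCM'
  constructor
  · refine c3.trans ?_
    rw [c5]
    gcongr
  · calc _ ≤ ENNReal.ofReal |LinearMap.det L| * (C ^ d * μH[(d:ℝ)] (P '' A)) := by gcongr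
      _ = C ^ d * (ENNReal.ofReal |LinearMap.det L| * μH[(d:ℝ)] (P '' A)) := by ring
      _ ≤ C ^ d * (C ^ d * μH[(d:ℝ)] (G '' A)) := by rw [← c5]; gcongr
      _ = C ^ d * C ^ d * μH[(d:ℝ)] (G '' A) := by ring
      _ ≤ _ := by gcongr

def sH (c : ℝ) : ℝ := √(1 - (min c 0) ^ 2)
def al (q c : ℝ) : ℝ := 2 * q / sH c + sH c ^ (q - 1) + sH c ^ (q + 1)
def gg (q c : ℝ) : ℝ := sH c ^ (q - 1) * (q + (q + 2) * sH c ^ 2)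
def bb (q c : ℝ) : ℝ :=
  (-(2 * q) / sH c ^ 2 + (q - 1) * sH c ^ (q - 2) + (q + 1) * sH c ^ q) / sH c
def zz (q c : ℝ) : ℝ := ∫ x in (-1)..c, gg q x
def et (q c : ℝ) : ℝ := al q c * (1 - c ^ 2) + zz q c * c
def ph (q c : ℝ) : ℝ := if c ≤ -1 then 2 * q else et q c / sH c

lemma sH_pos {c : ℝ} (hc : -1 < c) : 0 < sH c := by
  apply Real.sqrt_pos.2
  have h1 : -1 < min c 0 := lt_min hc (by norm_num)
  have h2 : min c 0 ≤ 0 := min_le_right _ _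
  nlinarith

lemma sH_of_nonneg {c : ℝ} (hc : 0 ≤ c) : sH c = 1 := by simp [sH, min_eq_right hc]

lemma sH_neg_one : sH (-1) = 0 := by simp [sH]

lemma sH_sq {c : ℝ} (hc : -1 ≤ c) (hc' : c ≤ 0) : sH c ^ 2 = 1 - c ^ 2 := by
  rw [sH, min_eq_left hc', Real.sq_sqrt]
  nlinarith

lemma sH_cont : Continuous sH := by unfold sH; fun_prop

lemma sH_le_one (c : ℝ) : sH c ≤ 1 := by
  rw [sH, Real.sqrt_le_one]
  nlinarith [sq_nonneg (min c 0)]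

lemma sqrt_le_sH {c : ℝ} : √(1 - c ^ 2) ≤ sH c := by
  apply Real.sqrt_le_sqrt
  rcases le_total c 0 with h | h
  · rw [min_eq_left h]
  · rw [min_eq_right h]; nlinarith

lemma minsq_deriv (c : ℝ) : HasDerivAt (fun x : ℝ => (min x 0) ^ 2) (2 * min c 0) c := by
  rcases lt_trichotomy c 0 with h | h | h
  · rw [min_eq_left h.le]
    have := (hasDerivAt_pow 2 c)
    simp only [Nat.cast_ofNat, Nat.add_one_sub_one, pow_one] at this
    apply this.congr_of_eventuallyEq
    filter_upwards [Iio_mem_nhds h] with x hx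
    rw [min_eq_left (le_of_lt hx)]
  · subst h
    rw [hasDerivAt_iff_isLittleO]
    simp only [min_self, mul_zero, smul_zero, sub_zero, ne_eq, OfNat.ofNat_ne_zero,
      not_false_eq_true, zero_pow]
    have h1 : (fun x : ℝ => (min x 0) ^ 2) =O[nhds 0] (fun x : ℝ => x ^ 2) := by
      apply Asymptotics.IsBigO.of_bound 1
      filter_upwards with x
      rw [one_mul, Real.norm_eq_abs, Real.norm_eq_abs, abs_of_nonneg (sq_nonneg _),
        abs_of_nonneg (sq_nonneg _)]
      rcases le_total x 0 with h | h
      · rw [min_eq_left h]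
      · rw [min_eq_right h]; nlinarith
    refine h1.trans_isLittleO ?_
    have := Asymptotics.isLittleO_pow_id (𝕜 := ℝ) (n := 2) (by norm_num)
    simpa using this
  · rw [min_eq_right h.le]
    have := (hasDerivAt_const c (0:ℝ))
    rw [mul_zero]
    apply this.congr_of_eventuallyEq
    filter_upwards [Ioi_mem_nhds h] with x hx
    rw [min_eq_right (le_of_lt hx)]
    norm_num

lemma sH_deriv {c : ℝ} (hc : -1 < c) : HasDerivAt sH (-(min c 0) / sH c) c := by
  have h0 : 1 - (min c 0) ^ 2 ≠ 0 := by
    have := sH_pos hc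
    exact (Real.sqrt_pos.1 this).ne'
  have := ((minsq_deriv c).const_sub 1).sqrt h0
  refine HasDerivAt.congr_deriv this ?_
  unfold sH
  ring

lemma bb_nonneg_zero (q : ℝ) {c : ℝ} (hc : 0 ≤ c) : bb q c = 0 := by
  simp [bb, sH_of_nonneg hc]; ring

lemma al_deriv' (q : ℝ) {c : ℝ} (hc : -1 < c) : HasDerivAt (al q) (-c * bb q c) c := by
  have hs := sH_pos hc
  have h1 := sH_deriv hc
  have h2 := (((hasDerivAt_const c (2 * q)).div h1 hs.ne').add
    (h1.rpow_const (p := q - 1) (Or.inl hs.ne'))).add (h1.rpow_const (p := q + 1) (Or.inl hs.ne'))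
  refine HasDerivAt.congr_deriv h2 ?_
  have key : min c 0 * bb q c = c * bb q c := by
    rcases le_total c 0 with h | h
    · rw [min_eq_left h]
    · rw [bb_nonneg_zero q h]; simp
  rw [neg_mul, ← key, bb]
  have e1 : q - 1 - 1 = q - 2 := by ring
  have e2 : q + 1 - 1 = q := by ring
  rw [e1, e2]
  field_simp
  ring

lemma bb_cont (q : ℝ) {c : ℝ} (hc : -1 < c) : ContinuousAt (bb q) c := by
  have hs := (sH_pos hc).ne'
  have := sH_cont.continuousAt (x := c)
  unfold bb
  refine ContinuousAt.div ?_ this hs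
  refine ((ContinuousAt.div continuousAt_const (this.pow 2) (pow_ne_zero 2 hs)).add ?_).add ?_
  · exact continuousAt_const.mul (this.rpow_const (Or.inl hs))
  · exact continuousAt_const.mul (this.rpow_const (Or.inl hs))

lemma gg_cont (q : ℝ) {c : ℝ} (hc : -1 < c) : ContinuousAt (gg q) c := by
  have hs := (sH_pos hc).ne'
  have := sH_cont.continuousAt (x := c)
  unfold gg
  exact (this.rpow_const (Or.inl hs)).mul (continuousAt_const.add (continuousAt_const.mul (this.pow 2)))

lemma al_strict (q : ℝ) {c : ℝ} (hc : -1 < c) : HasStrictDerivAt (al q) (-c * bb q c) c := by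
  apply hasStrictDerivAt_of_hasDerivAt_of_continuousAt (f' := fun c => -c * bb q c)
  · filter_upwards [Ioi_mem_nhds hc] with x hx using al_deriv' q hx
  · exact continuousAt_id.neg.mul (bb_cont q hc)

lemma gg_eq (q : ℝ) {c : ℝ} (hc : -1 < c) : gg q c = al q c + (1 - c ^ 2) * bb q c := by
  have hs := sH_pos hc
  rcases le_total c 0 with h | h
  · rw [← sH_sq hc.le h, gg, al, bb]
    have e1 : sH c ^ (q - 2) = sH c ^ (q - 1) / sH c := by
      rw [← Real.rpow_sub_one hs.ne']; congr 1; ring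
    have e2 : sH c ^ q = sH c ^ (q - 1) * sH c := by
      rw [← Real.rpow_add_one hs.ne']; congr 1; ring
    have e3 : sH c ^ (q + 1) = sH c ^ (q - 1) * sH c * sH c := by
      rw [← e2, ← Real.rpow_add_one hs.ne']
    rw [e1, e2, e3]
    field_simp
    ring
  · rw [bb_nonneg_zero q h, gg, al, sH_of_nonneg h]
    simp
    ring

lemma al_pos {q : ℝ} (hq : 0 < q) {c : ℝ} (hc : -1 < c) : 0 < al q c := by
  have hs := sH_pos hc
  unfold al; positivity

lemma gg_pos {q : ℝ} (hq : 0 < q) {c : ℝ} (hc : -1 < c) : 0 < gg q c := by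
  have hs := sH_pos hc
  unfold gg; positivity

lemma gg_int {q : ℝ} (hq : 0 < q) {c : ℝ} (hc : -1 ≤ c) :
    IntervalIntegrable (gg q) volume (-1) c := by
  have h0 : IntervalIntegrable (gg q) volume (-1) 0 := by
    have h1 : IntervalIntegrable (fun x : ℝ => (1 + x) ^ ((q - 1) / 2)) volume (-1) 0 := by
      have := (intervalIntegral.intervalIntegrable_rpow' (a := 0) (b := 1) (r := (q - 1) / 2)
        (by linarith)).comp_add_left 1
      simpa using this
    have h2 : ContinuousOn (fun x : ℝ => (1 - x) ^ ((q - 1) / 2) * (q + (q + 2) * (1 - x ^ 2)))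
        (uIcc (-1) 0) := by
      apply ContinuousOn.mul
      · apply ContinuousOn.rpow_const (by fun_prop)
        intro x hx
        rw [uIcc_of_le (by norm_num)] at hx
        left
        linarith [hx.2]
      · fun_prop
    refine (h1.mul_continuousOn h2).congr ?_
    intro x hx
    rw [uIoc_of_le (by norm_num)] at hx
    have hs := sH_pos hx.1
    have e : sH x ^ (q - 1) = (1 + x) ^ ((q - 1) / 2) * (1 - x) ^ ((q - 1) / 2) := by
      rw [← Real.mul_rpow (by linarith [hx.1]) (by linarith [hx.2])]
      have : (1 + x) * (1 - x) = sH x ^ (2:ℝ) := by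
        rw [Real.rpow_two, sH_sq hx.1.le hx.2]; ring
      rw [this, ← Real.rpow_mul hs.le]
      congr 1; ring
    simp only [gg]
    rw [e, sH_sq hx.1.le hx.2]
    ring
  rcases le_total c 0 with h | h
  · apply h0.mono_set
    rw [uIcc_of_le hc, uIcc_of_le (by norm_num)]
    exact Icc_subset_Icc_right h
  · refine h0.trans ?_
    apply ContinuousOn.intervalIntegrable
    intro x hx
    rw [uIcc_of_le h] at hx
    exact (gg_cont q (by linarith [hx.1])).continuousWithinAt

lemma zz_strict {q : ℝ} (hq : 0 < q) {c : ℝ} (hc : -1 < c) :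
    HasStrictDerivAt (zz q) (gg q c) c := by
  apply intervalIntegral.integral_hasStrictDerivAt_right (gg_int hq hc.le) _ (gg_cont q hc)
  refine ContinuousOn.stronglyMeasurableAtFilter isOpen_Ioi
    (fun x hx => (gg_cont q hx).continuousWithinAt) c (mem_Ioi.2 hc)

lemma zz_cont {q : ℝ} (hq : 0 < q) : ContinuousOn (zz q) (Icc (-1) 1) := by
  have := intervalIntegral.continuousOn_primitive_interval (f := gg q) (a := -1) (b := 1)
    (μ := volume) (by
      have := gg_int hq (c := 1) (by norm_num)
      rwa [intervalIntegrable_iff_integrableOn_Icc_of_le (by norm_num), ← uIcc_of_le (by norm_num)] at this)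
  rwa [uIcc_of_le (by norm_num)] at this

lemma zz_neg_one (q : ℝ) : zz q (-1) = 0 := by simp [zz]

lemma zz_mono {q : ℝ} (hq : 0 < q) : StrictMonoOn (zz q) (Icc (-1) 1) := by
  apply strictMonoOn_of_deriv_pos (convex_Icc _ _) (zz_cont hq)
  intro x hx
  rw [interior_Icc] at hx
  rw [(zz_strict hq hx.1).hasDerivAt.deriv]
  exact gg_pos hq hx.1

lemma zz_pos {q : ℝ} (hq : 0 < q) {c : ℝ} (hc : -1 < c) (hc1 : c ≤ 1) : 0 < zz q c := by
  rw [← zz_neg_one q]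
  exact zz_mono hq ⟨le_rfl, by norm_num⟩ ⟨hc.le, hc1⟩ hc

lemma zz_le {q : ℝ} (hq : 0 < q) {c : ℝ} (hc : -1 ≤ c) (hc1 : c ≤ -1 / 2) :
    zz q c ≤ 4 * sH c ^ (q + 1) := by
  have hm : MonotoneOn (fun c => 4 * sH c ^ (q + 1) - zz q c) (Icc (-1) (-1 / 2)) := by
    have hd : ∀ x ∈ Ioo (-1 : ℝ) (-1 / 2), HasDerivAt (fun c => 4 * sH c ^ (q + 1) - zz q c)
        (4 * (-(min x 0) / sH x * (q + 1) * sH x ^ (q + 1 - 1)) - gg q x) x := fun x hx =>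
      ((((sH_deriv hx.1).rpow_const (p := q + 1) (Or.inl (sH_pos hx.1).ne')).const_mul 4).sub
        (zz_strict hq hx.1).hasDerivAt)
    apply monotoneOn_of_deriv_nonneg (convex_Icc _ _)
    · apply ContinuousOn.sub
      · apply ContinuousOn.mul continuousOn_const
        exact sH_cont.continuousOn.rpow_const (fun x hx => Or.inr (by linarith))
      · exact (zz_cont hq).mono (Icc_subset_Icc_right (by norm_num))
    · intro x hx
      rw [interior_Icc] at hx
      exact (hd x hx).differentiableAt.differentiableWithinAt
    · intro x hx
      rw [interior_Icc] at hx
      rw [(hd x hx).deriv]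
      have hs := sH_pos hx.1
      have hx2 := hx.2
      rw [min_eq_left (by linarith), gg]
      have e2 : sH x ^ (q + 1 - 1) = sH x ^ (q - 1) * sH x := by
        rw [← Real.rpow_add_one hs.ne']; congr 1; ring
      rw [e2]
      have e3 : 4 * (-x / sH x * (q + 1) * (sH x ^ (q - 1) * sH x)) -
          sH x ^ (q - 1) * (q + (q + 2) * sH x ^ 2) =
          sH x ^ (q - 1) * (4 * -x * (q + 1) - (q + (q + 2) * sH x ^ 2)) := by
        field_simp
      rw [e3]
      apply mul_nonneg (by positivity)
      have h1 : sH x ^ 2 ≤ 1 := by nlinarith [sH_le_one x]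
      nlinarith
  have := hm ⟨le_rfl, by norm_num⟩ ⟨hc, hc1⟩ hc
  simp only [zz_neg_one, sH_neg_one] at this
  rw [Real.zero_rpow (by linarith)] at this
  linarith

lemma al_mul {q : ℝ} {c : ℝ} (hc : -1 < c) :
    al q c = (2 * q + sH c ^ q + sH c ^ (q + 2)) / sH c := by
  have hs := sH_pos hc
  have e1 : sH c ^ (q - 1) = sH c ^ q / sH c := Real.rpow_sub_one hs.ne' _
  have e2 : sH c ^ (q + 1) = sH c ^ (q + 2) / sH c := by
    rw [← Real.rpow_sub_one hs.ne']; congr 1; ring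
  rw [al, e1, e2]; ring

lemma et_cont_at {q : ℝ} (hq : 0 < q) {c : ℝ} (hc : -1 < c) : ContinuousAt (et q) c := by
  have h1 := (al_strict q hc).hasDerivAt.continuousAt
  have h2 := (zz_strict hq hc).hasDerivAt.continuousAt
  unfold et
  exact (h1.mul (by fun_prop)).add (h2.mul continuousAt_id)

lemma ph_cont {q : ℝ} (hq : 0 < q) : ContinuousOn (ph q) (Icc (-1) 1) := by
  intro c hc
  rcases hc.1.lt_or_eq with h | h
  · apply ContinuousAt.continuousWithinAt
    have : ContinuousAt (fun c => et q c / sH c) c :=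
      (et_cont_at hq h).div sH_cont.continuousAt (sH_pos h).ne'
    apply this.congr
    filter_upwards [Ioi_mem_nhds h] with x hx
    rw [ph, if_neg (not_le.2 hx)]
  · subst h
    have hlim : Filter.Tendsto (fun c => 2 * q + sH c ^ q + sH c ^ (q + 2)) (nhds (-1))
        (nhds (2 * q)) := by
      have : Continuous (fun c => 2 * q + sH c ^ q + sH c ^ (q + 2)) :=
        (continuous_const.add (sH_cont.rpow_const (fun x => Or.inr hq.le))).add
          (sH_cont.rpow_const (fun x => Or.inr (by linarith)))
      have h2 := this.tendsto (-1)
      simpa [sH_neg_one, Real.zero_rpow hq.ne', Real.zero_rpow (show q + 2 ≠ 0 by linarith)] using h2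
    have hlow : Filter.Tendsto (fun c => 2 * q + sH c ^ q + sH c ^ (q + 2) - 4 * sH c ^ q)
        (nhds (-1)) (nhds (2 * q)) := by
      have : Continuous (fun c => 4 * sH c ^ q) :=
        continuous_const.mul (sH_cont.rpow_const (fun x => Or.inr hq.le))
      have h2 := hlim.sub (this.tendsto (-1))
      simpa [sH_neg_one, Real.zero_rpow hq.ne'] using h2
    have heq : ∀ x, -1 < x → x < -1 / 2 → ph q x =
        2 * q + sH x ^ q + sH x ^ (q + 2) + zz q x * x / sH x := by
      intro x hx hx2
      have hs := sH_pos hx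
      rw [ph, if_neg (not_le.2 hx), et, al_mul hx, ← sH_sq hx.le (by linarith)]
      field_simp
    have hv : ph q (-1) = 2 * q := by simp [ph]
    rw [ContinuousWithinAt, hv]
    have hev : ∀ᶠ x in nhdsWithin (-1 : ℝ) (Icc (-1) 1), x < -1 / 2 :=
      nhdsWithin_le_nhds (Iio_mem_nhds (by norm_num))
    apply tendsto_of_tendsto_of_tendsto_of_le_of_le' (hlow.mono_left nhdsWithin_le_nhds)
      (hlim.mono_left nhdsWithin_le_nhds)
    · filter_upwards [hev, self_mem_nhdsWithin] with x hx1 hx2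
      rcases hx2.1.lt_or_eq with h | h
      · rw [heq x h hx1]
        have hs := sH_pos h
        have h1 := zz_le hq h.le hx1.le
        have h0 := zz_pos hq h hx2.2
        have h3 : - (4 * sH x ^ q) ≤ zz q x * x / sH x := by
          rw [le_div_iff₀ hs, neg_mul, mul_assoc, ← Real.rpow_add_one hs.ne']
          nlinarith
        linarith
      · rw [← h, hv, sH_neg_one, Real.zero_rpow hq.ne', Real.zero_rpow (show q + 2 ≠ 0 by linarith)]
        linarith
    · filter_upwards [hev, self_mem_nhdsWithin] with x hx1 hx2
      rcases hx2.1.lt_or_eq with h | h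
      · rw [heq x h hx1]
        have hs := sH_pos h
        have h0 := zz_pos hq h hx2.2
        have h3 : zz q x * x / sH x ≤ 0 :=
          div_nonpos_of_nonpos_of_nonneg (by nlinarith) hs.le
        linarith
      · rw [← h, hv, sH_neg_one, Real.zero_rpow hq.ne', Real.zero_rpow (show q + 2 ≠ 0 by linarith)]
        linarith

lemma et_neg_one (q : ℝ) : et q (-1) = 0 := by simp [et, zz_neg_one]

lemma et_eq (q : ℝ) {c : ℝ} (hc : -1 ≤ c) : et q c = sH c * ph q c := by
  rcases hc.lt_or_eq with h | h
  · have hs := sH_pos h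
    rw [ph, if_neg (not_le.2 h)]
    field_simp
  · rw [← h, et_neg_one, sH_neg_one, zero_mul]

lemma et_cont {q : ℝ} (hq : 0 < q) : ContinuousOn (et q) (Icc (-1) 1) :=
  (sH_cont.continuousOn.mul (ph_cont hq)).congr fun _ hx => et_eq q hx.1

lemma et_pos {q : ℝ} (hq : 0 < q) {c : ℝ} (hc : -1 < c) (hc1 : c ≤ 1) : 0 < et q c := by
  rcases le_or_gt c 0 with h | h
  · have hm : StrictMonoOn (et q) (Icc (-1) 0) := by
      apply strictMonoOn_of_deriv_pos (convex_Icc _ _)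
        ((et_cont hq).mono (Icc_subset_Icc_right (by norm_num)))
      intro x hx
      rw [interior_Icc] at hx
      have hd : HasDerivAt (et q) _ x :=
        ((al_deriv' q hx.1).mul ((hasDerivAt_pow 2 x).const_sub 1)).add
          ((zz_strict hq hx.1).hasDerivAt.mul (hasDerivAt_id x))
      rw [hd.deriv, gg_eq q hx.1]
      have h1 := al_pos hq hx.1
      have h2 := zz_pos hq hx.1 (by linarith [hx.2])
      simp only [Nat.cast_ofNat, Nat.add_one_sub_one, pow_one]
      nlinarith [hx.2]
    rw [← et_neg_one q]
    exact hm ⟨le_rfl, by norm_num⟩ ⟨hc.le, h⟩ hc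
  · have h1 := al_pos hq hc
    have h2 := zz_pos hq hc hc1
    have h3 : 0 ≤ 1 - c ^ 2 := by nlinarith
    unfold et
    positivity

lemma ph_pos {q : ℝ} (hq : 0 < q) {c : ℝ} (hc1 : c ≤ 1) : 0 < ph q c := by
  unfold ph
  split_ifs with h
  · linarith
  · push Not at h
    exact div_pos (et_pos hq h hc1) (sH_pos h)

lemma et_ineq {q : ℝ} (hq : 0 < q) {c d : ℝ} (hc : -1 < c) (hc1 : c ≤ 1) (hd : -1 ≤ d)
    (hd1 : d ≤ 1) : al q c * (√(1 - c ^ 2) * √(1 - d ^ 2)) + zz q c * d ≤ et q d := by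
  rcases hd.lt_or_eq with hd | hd
  swap
  · subst hd
    rw [et_neg_one]
    have := zz_pos hq hc hc1
    norm_num
    linarith
  let Q : ℝ → ℝ := fun c => al q c * (√(1 - c ^ 2) * √(1 - d ^ 2)) + zz q c * d
  have hQd : Q d = et q d := by
    simp only [Q, et]
    rw [Real.mul_self_sqrt (by nlinarith)]
  have hcont : ContinuousOn Q (Ioc (-1) 1) := by
    intro x hx
    have h1 := (al_strict q hx.1).hasDerivAt.continuousAt
    have h2 := (zz_strict hq hx.1).hasDerivAt.continuousAt
    apply ContinuousAt.continuousWithinAt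
    exact (h1.mul (by fun_prop)).add (h2.mul continuousAt_const)
  have hder : ∀ x ∈ Ioo (-1 : ℝ) 1, HasDerivAt Q
      (gg q x * (d * √(1 - x ^ 2) - x * √(1 - d ^ 2)) / √(1 - x ^ 2)) x := by
    intro x hx
    have hx0 : 0 < 1 - x ^ 2 := by nlinarith [hx.1, hx.2]
    have hs := Real.sqrt_pos.2 hx0
    have h := ((al_deriv' q hx.1).mul ((((hasDerivAt_pow 2 x).const_sub 1).sqrt hx0.ne').mul_const
      (√(1 - d ^ 2)))).add ((zz_strict hq hx.1).hasDerivAt.mul_const d)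
    refine HasDerivAt.congr_deriv h ?_
    have hsq : 1 - x ^ 2 = √(1 - x ^ 2) ^ 2 := (Real.sq_sqrt hx0.le).symm
    rw [gg_eq q hx.1]
    generalize √(1 - x ^ 2) = s at *
    rw [hsq]
    push_cast
    field_simp
    ring_nf
  rw [← hQd]
  change Q c ≤ Q d
  rcases le_total c d with hcd | hcd
  · have hm : MonotoneOn Q (Ioc (-1) d) := by
      apply monotoneOn_of_deriv_nonneg (convex_Ioc _ _) (hcont.mono (Ioc_subset_Ioc_right hd1))
      · intro x hx
        rw [interior_Ioc] at hx
        exact (hder x ⟨hx.1, by linarith [hx.2]⟩).differentiableAt.differentiableWithinAt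
      · intro x hx
        rw [interior_Ioc] at hx
        rw [(hder x ⟨hx.1, by linarith [hx.2]⟩).deriv]
        apply div_nonneg _ (Real.sqrt_nonneg _)
        apply mul_nonneg (gg_pos hq hx.1).le
        have h1 := hx.1
        have h2 := hx.2
        rcases le_total 0 x with h0 | h0
        · have : √(1 - d ^ 2) ≤ √(1 - x ^ 2) := Real.sqrt_le_sqrt (by nlinarith)
          nlinarith [Real.sqrt_nonneg (1 - d ^ 2)]
        rcases le_total 0 d with h3 | h3
        · nlinarith [Real.sqrt_nonneg (1 - d ^ 2), Real.sqrt_nonneg (1 - x ^ 2),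
            mul_nonneg h3 (Real.sqrt_nonneg (1 - x ^ 2)), mul_nonneg (neg_nonneg.2 h0) (Real.sqrt_nonneg (1 - d ^ 2))]
        · have : √(1 - x ^ 2) ≤ √(1 - d ^ 2) := Real.sqrt_le_sqrt (by nlinarith)
          nlinarith [Real.sqrt_nonneg (1 - x ^ 2)]
    exact hm ⟨hc, hcd⟩ ⟨hd, le_rfl⟩ hcd
  · have hm : AntitoneOn Q (Icc d 1) := by
      apply antitoneOn_of_deriv_nonpos (convex_Icc _ _)
        (hcont.mono (fun x hx => ⟨by linarith [hx.1], hx.2⟩))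
      · intro x hx
        rw [interior_Icc] at hx
        exact (hder x ⟨by linarith [hx.1], hx.2⟩).differentiableAt.differentiableWithinAt
      · intro x hx
        rw [interior_Icc] at hx
        have hx1 : -1 < x := by linarith [hx.1]
        rw [(hder x ⟨hx1, hx.2⟩).deriv]
        apply div_nonpos_of_nonpos_of_nonneg _ (Real.sqrt_nonneg _)
        apply mul_nonpos_of_nonneg_of_nonpos (gg_pos hq hx1).le
        have h1 := hx.1
        have h2 := hx.2
        rcases le_total 0 d with h0 | h0
        · have : √(1 - x ^ 2) ≤ √(1 - d ^ 2) := Real.sqrt_le_sqrt (by nlinarith)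
          nlinarith [Real.sqrt_nonneg (1 - x ^ 2)]
        rcases le_total 0 x with h3 | h3
        · nlinarith [mul_nonneg h3 (Real.sqrt_nonneg (1 - d ^ 2)), mul_nonneg (neg_nonneg.2 h0) (Real.sqrt_nonneg (1 - x ^ 2))]
        · have : √(1 - d ^ 2) ≤ √(1 - x ^ 2) := Real.sqrt_le_sqrt (by nlinarith)
          nlinarith [Real.sqrt_nonneg (1 - d ^ 2)]
    exact hm ⟨le_rfl, hd1⟩ ⟨hcd, hc1⟩ hcd

lemma aux_finrank {n : ℕ} (u : EuclideanSpace ℝ (Fin n)) (hu : ‖u‖ = 1) :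
    Module.finrank ℝ (ℝ ∙ u)ᗮ = n - 1 := by
  have h1 := Submodule.finrank_add_finrank_orthogonal (ℝ ∙ u)
  have h0 : u ≠ 0 := by
    rintro rfl
    simp at hu
  rw [finrank_span_singleton h0, finrank_euclideanSpace_fin] at h1
  omega

def GG {n : ℕ} (q : ℝ) (e x : EuclideanSpace ℝ (Fin n)) : EuclideanSpace ℝ (Fin n) :=
  al q ⟪e, x⟫ • (x - ⟪e, x⟫ • e) + zz q ⟪e, x⟫ • e

def KK {n : ℕ} (q : ℝ) (e : EuclideanSpace ℝ (Fin n)) : Set (EuclideanSpace ℝ (Fin n)) :=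
  {y | ∀ u, ‖u‖ = 1 → ⟪u, y⟫ ≤ et q ⟪e, u⟫}

section geom
variable {n : ℕ} {q : ℝ} {e : EuclideanSpace ℝ (Fin n)}

lemma aux_le_one (he : ‖e‖ = 1) {u : EuclideanSpace ℝ (Fin n)} (hu : ‖u‖ = 1) : ⟪e, u⟫ ≤ 1 := by
  have := real_inner_le_norm e u
  rwa [he, hu, one_mul] at this

lemma aux_ge (he : ‖e‖ = 1) {u : EuclideanSpace ℝ (Fin n)} (hu : ‖u‖ = 1) : -1 ≤ ⟪e, u⟫ := by
  have := abs_real_inner_le_norm e u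
  rw [he, hu, one_mul] at this
  exact (abs_le.1 this).1

lemma aux_gt (he : ‖e‖ = 1) {u : EuclideanSpace ℝ (Fin n)} (hu : ‖u‖ = 1) (hne : u ≠ -e) :
    -1 < ⟪e, u⟫ := by
  refine lt_of_le_of_ne (aux_ge he hu) fun h => hne ?_
  have : ‖u + e‖ ^ 2 = 0 := by
    rw [norm_add_sq_real, real_inner_comm, ← h, hu, he]; norm_num
  have h2 : u + e = 0 := by simpa using this
  exact eq_neg_of_add_eq_zero_left h2

lemma aux_proj_norm (he : ‖e‖ = 1) {u : EuclideanSpace ℝ (Fin n)} (hu : ‖u‖ = 1) :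
    ‖u - ⟪e, u⟫ • e‖ = √(1 - ⟪e, u⟫ ^ 2) := by
  have h : ‖u - ⟪e, u⟫ • e‖ ^ 2 = 1 - ⟪e, u⟫ ^ 2 := by
    rw [norm_sub_sq_real, norm_smul, real_inner_smul_right, real_inner_comm e u, hu, he,
      Real.norm_eq_abs, mul_one, sq_abs]
    ring
  rw [← h, Real.sqrt_sq (norm_nonneg _)]

lemma GG_inner (u v : EuclideanSpace ℝ (Fin n)) :
    ⟪u, GG q e v⟫ = al q ⟪e, v⟫ * (⟪u, v⟫ - ⟪e, v⟫ * ⟪e, u⟫) + zz q ⟪e, v⟫ * ⟪e, u⟫ := by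
  simp only [GG, inner_add_right, inner_smul_right, inner_sub_right, real_inner_comm e u]

lemma GG_self {u : EuclideanSpace ℝ (Fin n)} (hu : ‖u‖ = 1) :
    ⟪u, GG q e u⟫ = et q ⟪e, u⟫ := by
  rw [GG_inner, et, real_inner_self_eq_norm_sq, hu]; ring

lemma GG_le (hq : 0 < q) (he : ‖e‖ = 1) {u v : EuclideanSpace ℝ (Fin n)} (hu : ‖u‖ = 1)
    (hv : ‖v‖ = 1) (hne : v ≠ -e) : ⟪u, GG q e v⟫ ≤ et q ⟪e, u⟫ := by
  refine le_trans ?_ (et_ineq hq (aux_gt he hv hne) (aux_le_one he hv) (aux_ge he hu)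
    (aux_le_one he hu))
  rw [GG_inner]
  have h1 := real_inner_le_norm (v - ⟪e, v⟫ • e) (u - ⟪e, u⟫ • e)
  rw [aux_proj_norm he hu, aux_proj_norm he hv] at h1
  have h2 : ⟪v - ⟪e, v⟫ • e, u - ⟪e, u⟫ • e⟫ = ⟪u, v⟫ - ⟪e, v⟫ * ⟪e, u⟫ := by
    simp only [inner_sub_left, inner_sub_right, inner_smul_left, inner_smul_right,
      real_inner_self_eq_norm_sq, he, real_inner_comm e v, real_inner_comm u v]
    simp
  rw [h2] at h1
  have := al_pos hq (aux_gt he hv hne)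
  gcongr

lemma GG_mem (hq : 0 < q) (he : ‖e‖ = 1) {v : EuclideanSpace ℝ (Fin n)}
    (hv : ‖v‖ = 1) (hne : v ≠ -e) : GG q e v ∈ KK q e := fun _ hu => GG_le hq he hu hv hne

lemma et_nonneg' (hq : 0 < q) (he : ‖e‖ = 1) {u : EuclideanSpace ℝ (Fin n)} (hu : ‖u‖ = 1) :
    0 ≤ et q ⟪e, u⟫ := by
  rcases (aux_ge he hu).lt_or_eq with h | h
  · exact (et_pos hq h (aux_le_one he hu)).le
  · rw [← h, et_neg_one]

lemma KK_zero (hq : 0 < q) (he : ‖e‖ = 1) : (0 : EuclideanSpace ℝ (Fin n)) ∈ KK q e := by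
  intro u hu
  rw [inner_zero_right]
  exact et_nonneg' hq he hu

lemma KK_suppFn (hq : 0 < q) (he : ‖e‖ = 1) {u : EuclideanSpace ℝ (Fin n)} (hu : ‖u‖ = 1) :
    suppFn (KK q e) u = et q ⟪e, u⟫ := by
  apply IsGreatest.csSup_eq
  constructor
  · by_cases hne : u = -e
    · refine ⟨0, KK_zero hq he, ?_⟩
      subst hne
      simp [he, et_neg_one]
    · exact ⟨_, GG_mem hq he hu hne, GG_self hu⟩
  · rintro _ ⟨y, hy, rfl⟩
    exact hy u hu

lemma GG_strict (hq : 0 < q) (he : ‖e‖ = 1) {u : EuclideanSpace ℝ (Fin n)} (hu : -1 < ⟪e, u⟫) :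
    ∃ G' : EuclideanSpace ℝ (Fin n) →L[ℝ] EuclideanSpace ℝ (Fin n),
      HasStrictFDerivAt (GG q e) G' u ∧
      ∀ v, G' v = al q ⟪e, u⟫ • v + (⟪e, v⟫ * bb q ⟪e, u⟫) • (e - ⟪e, u⟫ • u) := by
  have hl : HasStrictFDerivAt (fun x : EuclideanSpace ℝ (Fin n) => ⟪e, x⟫) (innerSL ℝ e) u :=
    (innerSL ℝ e).hasStrictFDerivAt
  have ha := (al_strict q hu).comp_hasStrictFDerivAt u hl
  have hz := (zz_strict hq hu).comp_hasStrictFDerivAt u hl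
  have h := (ha.smul ((hasStrictFDerivAt_id u).sub (hl.smul_const e))).add (hz.smul_const e)
  refine ⟨_, h, fun v => ?_⟩
  simp only [add_apply, _root_.smul_apply, ContinuousLinearMap.smulRight_apply,
    _root_.sub_apply, Pi.sub_apply, id_eq, innerSL_apply_apply, Function.comp, id, smul_eq_mul,
    ContinuousLinearMap.id_apply]
  rw [gg_eq q hu]
  module

lemma KK_face (hq : 0 < q) (he : ‖e‖ = 1) {u : EuclideanSpace ℝ (Fin n)} (hu : ‖u‖ = 1)
    (hne : u ≠ -e) : face (KK q e) u = {GG q e u} := by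
  have hu0 : u ≠ 0 := by rintro rfl; simp at hu
  ext z
  simp only [face, mem_ofPred_eq, mem_singleton_iff, KK_suppFn hq he hu]
  constructor
  swap
  · rintro rfl
    exact ⟨GG_mem hq he hu hne, by rw [real_inner_comm, GG_self hu]⟩
  rintro ⟨hz, hzu⟩
  obtain ⟨G', hG', -⟩ := GG_strict hq he (aux_gt he hu hne)
  have hGc : ContinuousAt (GG q e) u := hG'.hasFDerivAt.continuousAt
  let N : EuclideanSpace ℝ (Fin n) → EuclideanSpace ℝ (Fin n) := fun x => ‖x‖⁻¹ • x
  have hNu : N u = u := by simp [N, hu]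
  have hNc : ContinuousAt N u := by
    exact (continuousAt_id.norm.inv₀ (by simp [hu])).smul continuousAt_id
  have key : ∀ v, ⟪v, z - GG q e u⟫ ≤ 0 := by
    intro v
    have hpath : Filter.Tendsto (fun t : ℝ => u + t • v) (nhdsWithin 0 (Ioi 0)) (nhds u) := by
      apply Filter.Tendsto.mono_left _ nhdsWithin_le_nhds
      have : Continuous (fun t : ℝ => u + t • v) := by fun_prop
      simpa using this.tendsto 0
    have hGN : ContinuousAt (fun x => GG q e (N x)) u :=
      ContinuousAt.comp (g := GG q e) (by rw [hNu]; exact hGc) hNc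
    have hlim : Filter.Tendsto (fun t : ℝ => ⟪v, z - GG q e (N (u + t • v))⟫)
        (nhdsWithin 0 (Ioi 0)) (nhds ⟪v, z - GG q e u⟫) := by
      have h1 := hGN.tendsto.comp hpath
      simp only [hNu] at h1
      exact (tendsto_const_nhds).inner (tendsto_const_nhds.sub h1)
    refine le_of_tendsto hlim ?_
    have hne' : ∀ᶠ x in nhds u, N x ≠ -e := hNc.eventually_ne (by rwa [hNu])
    have h0' : ∀ᶠ x in nhds u, x ≠ 0 := eventually_ne_nhds hu0
    filter_upwards [hpath.eventually hne', hpath.eventually h0', self_mem_nhdsWithin] with t h1 h2 ht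
    set x := u + t • v with hx
    have hxn : 0 < ‖x‖ := norm_pos_iff.2 h2
    have hN1 : ‖N x‖ = 1 := by simp [N, norm_smul, hxn.ne']
    have i1 : ⟪N x, z⟫ ≤ ⟪N x, GG q e (N x)⟫ := by rw [GG_self hN1]; exact hz _ hN1
    have i2 : ⟪u, GG q e (N x)⟫ ≤ ⟪u, z⟫ := by
      rw [real_inner_comm z u, hzu]; exact GG_le hq he hu hN1 h1
    have i3 : ⟪x, z⟫ ≤ ⟪x, GG q e (N x)⟫ := by
      have hxN : x = ‖x‖ • N x := by simp [N, smul_smul, hxn.ne']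
      have hw : ∀ w, ⟪x, w⟫ = ‖x‖ * ⟪N x, w⟫ := fun w => by
        conv_lhs => rw [hxN]
        rw [real_inner_smul_left]
      rw [hw, hw]
      gcongr
    have i4 : t * ⟪v, z - GG q e (N x)⟫ = ⟪x, z - GG q e (N x)⟫ - ⟪u, z - GG q e (N x)⟫ := by
      conv_rhs => rw [hx, inner_add_left, real_inner_smul_left]
      ring
    rw [inner_sub_right x, inner_sub_right u] at i4
    have ht' : 0 < t := ht
    by_contra hcon
    push Not at hcon
    have := mul_pos ht' hcon
    linarith
  have := key (z - GG q e u)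
  rw [real_inner_self_nonpos] at this
  exact sub_eq_zero.1 this

lemma GG_inj (hq : 0 < q) (he : ‖e‖ = 1) :
    InjOn (GG q e) {u : EuclideanSpace ℝ (Fin n) | ‖u‖ = 1 ∧ u ≠ -e} := by
  rintro u ⟨hu, hue⟩ v ⟨hv, hve⟩ h
  have hz : ∀ x : EuclideanSpace ℝ (Fin n), ⟪e, GG q e x⟫ = zz q ⟪e, x⟫ := fun x => by
    rw [GG_inner, real_inner_self_eq_norm_sq, he]; ring
  have h1 : zz q ⟪e, u⟫ = zz q ⟪e, v⟫ := by rw [← hz, ← hz, h]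
  have h2 : ⟪e, u⟫ = ⟪e, v⟫ := (zz_mono hq).injOn ⟨aux_ge he hu, aux_le_one he hu⟩
    ⟨aux_ge he hv, aux_le_one he hv⟩ h1
  have h3 := al_pos hq (aux_gt he hv hve)
  simp only [GG, h2] at h
  have h4 := smul_right_injective _ h3.ne' (add_right_cancel h)
  exact sub_left_injective h4

lemma GG_area (hn : 2 ≤ n) (hq : 0 < q) (he : ‖e‖ = 1) (ω : Set (EuclideanSpace ℝ (Fin n)))
    (hω : MeasurableSet ω) (hωS : ω ⊆ {u | ‖u‖ = 1 ∧ u ≠ -e}) :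
    μH[(n : ℝ) - 1] (GG q e '' ω)
      = ∫⁻ u in ω, ENNReal.ofReal (al q ⟪e, u⟫ ^ (n - 2) * gg q ⟪e, u⟫) ∂μH[(n : ℝ) - 1] := by
  have hn' : (n : ℝ) - 1 = ((n - 1 : ℕ) : ℝ) := by
    rw [Nat.cast_sub (by omega)]; simp
  rw [hn']
  have hin : Continuous (fun u : EuclideanSpace ℝ (Fin n) => ⟪e, u⟫) := by fun_prop
  apply aux_density _ _ {u | ‖u‖ = 1 ∧ u ≠ -e}
    (fun u : EuclideanSpace ℝ (Fin n) => al q ⟪e, u⟫ ^ (n - 2) * gg q ⟪e, u⟫) _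
    (GG_inj hq he) _ _ _ ω hω hωS
  · rintro u ⟨hu, hue⟩
    obtain ⟨G', hG', -⟩ := GG_strict hq he (aux_gt he hu hue)
    exact hG'.hasFDerivAt.continuousAt.continuousWithinAt
  · rintro u ⟨hu, hue⟩
    have hc := aux_gt he hu hue
    apply ContinuousAt.continuousWithinAt
    have h1 : ContinuousAt (fun u : EuclideanSpace ℝ (Fin n) => al q ⟪e, u⟫) u :=
      ContinuousAt.comp (g := al q) (al_strict q hc).hasDerivAt.continuousAt hin.continuousAt
    have h2 : ContinuousAt (fun u : EuclideanSpace ℝ (Fin n) => gg q ⟪e, u⟫) u :=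
      ContinuousAt.comp (g := gg q) (gg_cont q hc) hin.continuousAt
    exact (h1.pow _).mul h2
  · rintro u ⟨hu, hue⟩
    have hc := aux_gt he hu hue
    exact mul_pos (pow_pos (al_pos hq hc) _) (gg_pos hq hc)
  · rintro M hM u ⟨hu, hue⟩
    have hc := aux_gt he hu hue
    have ha := al_pos hq hc
    obtain ⟨G', hG', hG'v⟩ := GG_strict hq he hc
    set c := ⟪e, u⟫ with hcdef
    have hw : e - c • u ∈ (ℝ ∙ u)ᗮ := by
      rw [Submodule.mem_orthogonal_singleton_iff_inner_right, inner_sub_right, inner_smul_right,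
        real_inner_self_eq_norm_sq, hu, real_inner_comm, ← hcdef]
      ring
    let f : Module.Dual ℝ (ℝ ∙ u)ᗮ := (innerSL ℝ e).toLinearMap ∘ₗ (ℝ ∙ u)ᗮ.subtype
    let w : (ℝ ∙ u)ᗮ := (bb q c / al q c) • ⟨e - c • u, hw⟩
    let L : (ℝ ∙ u)ᗮ →ₗ[ℝ] (ℝ ∙ u)ᗮ := al q c • LinearMap.transvection f w
    have hdet : LinearMap.det L = al q c ^ (n - 2) * gg q c := by
      have h1 : f w = bb q c / al q c * (1 - c ^ 2) := by
        simp only [f, w, map_smul, LinearMap.comp_apply, Submodule.subtype_apply, smul_eq_mul]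
        simp only [ContinuousLinearMap.coe_coe, innerSL_apply_apply, inner_sub_right,
          inner_smul_right, real_inner_self_eq_norm_sq, he, ← hcdef]
        ring
      have h2 : n - 1 = n - 2 + 1 := by omega
      rw [LinearMap.det_smul, LinearMap.transvection.det, aux_finrank u hu, h1, gg_eq q hc, h2,
        pow_succ]
      field_simp
    have hdp : 0 < LinearMap.det L := by
      rw [hdet]
      exact mul_pos (pow_pos ha _) (gg_pos hq hc)
    obtain ⟨U, hU, hUA⟩ := aux_local u hu (GG q e) G' hG' L hdp.ne' (by
      intro v
      rw [hG'v]
      simp only [L, w, f, LinearMap.smul_apply, LinearMap.transvection.apply, Submodule.coe_smul,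
        Submodule.coe_add, LinearMap.comp_apply, Submodule.subtype_apply,
        ContinuousLinearMap.coe_coe, innerSL_apply_apply, smul_add, smul_smul]
      congr 2
      field_simp) (n - 1) (aux_finrank u hu) M hM
    refine ⟨U, mem_nhdsWithin_of_mem_nhds hU, fun A hA hAS => ?_⟩
    have := hUA A hA (fun x hx => by simpa using (hAS hx).1)
    rwa [abs_of_pos hdp, hdet] at this
end geom

section final
variable {n : ℕ} {q : ℝ} {e : EuclideanSpace ℝ (Fin n)}

lemma KK_convex : Convex ℝ (KK q e) := by
  intro x hx y hy a b ha hb hab u hu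
  have h1 := hx u hu
  have h2 := hy u hu
  rw [inner_add_right, inner_smul_right, inner_smul_right]
  have : et q ⟪e, u⟫ = a * et q ⟪e, u⟫ + b * et q ⟪e, u⟫ := by rw [← add_mul, hab, one_mul]
  rw [this]
  gcongr

lemma KK_compact (hq : 0 < q) (he : ‖e‖ = 1) : IsCompact (KK q e) := by
  apply Metric.isCompact_of_isClosed_isBounded
  · have : KK q e = ⋂ u, ⋂ (_ : ‖u‖ = 1), {y | ⟪u, y⟫ ≤ et q ⟪e, u⟫} := by
      ext y; simp [KK]
    rw [this]
    refine isClosed_iInter fun u => isClosed_iInter fun _ => ?_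
    exact isClosed_le (by fun_prop) continuous_const
  · obtain ⟨M, hM⟩ := (isCompact_Icc.image_of_continuousOn (et_cont hq)).bddAbove
    rw [isBounded_iff_forall_norm_le]
    refine ⟨M, fun y hy => ?_⟩
    by_cases hy0 : y = 0
    · have := hM ⟨-1, by norm_num, et_neg_one q⟩
      simpa [hy0] using this
    · have hp : 0 < ‖y‖ := norm_pos_iff.2 hy0
      have hu : ‖‖y‖⁻¹ • y‖ = 1 := by simp [norm_smul, hp.ne']
      have h1 := hy _ hu
      rw [real_inner_smul_left, real_inner_self_eq_norm_sq] at h1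
      have h2 : ‖y‖⁻¹ * ‖y‖ ^ 2 = ‖y‖ := by field_simp
      rw [h2] at h1
      exact h1.trans (hM ⟨_, ⟨aux_ge he hu, aux_le_one he hu⟩, rfl⟩)

lemma KK_interior (hq : 0 < q) (he : ‖e‖ = 1) : (interior (KK q e)).Nonempty := by
  have hz0 : 0 < zz q 0 := zz_pos hq (by norm_num) (by norm_num)
  have hc : ContinuousOn (fun c => et q c - zz q 0 / 2 * c) (Icc (-1) 1) :=
    (et_cont hq).sub (by fun_prop)
  obtain ⟨c0, hc0, hmin⟩ := isCompact_Icc.exists_isMinOn ⟨1, by norm_num⟩ hc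
  have hpos : ∀ c ∈ Icc (-1 : ℝ) 1, 0 < et q c - zz q 0 / 2 * c := by
    rintro c ⟨h1, h2⟩
    rcases lt_or_ge c 0 with h | h
    · have : 0 ≤ et q c := by
        rw [et_eq q h1]
        exact mul_nonneg (Real.sqrt_nonneg _) (ph_pos hq h2).le
      nlinarith
    · have h3 : zz q 0 ≤ zz q c := (zz_mono hq).monotoneOn (by norm_num) ⟨h1, h2⟩ h
      have h4 := al_pos hq (c := c) (by linarith)
      unfold et
      have h5 : 0 ≤ (zz q c - zz q 0) * c := mul_nonneg (by linarith) h
      rcases h.lt_or_eq with h6 | h6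
      · have h7 : 0 ≤ al q c * (1 - c ^ 2) := mul_nonneg h4.le (by nlinarith)
        nlinarith [mul_pos hz0 h6]
      · subst h6
        simpa using h4
  set r := et q c0 - zz q 0 / 2 * c0 with hr
  have hrp : 0 < r := hpos c0 hc0
  refine ⟨(zz q 0 / 2) • e, mem_interior.2 ⟨Metric.ball ((zz q 0 / 2) • e) r, ?_, Metric.isOpen_ball,
    Metric.mem_ball_self hrp⟩⟩
  intro y hy u hu
  have h1 : r ≤ et q ⟪e, u⟫ - zz q 0 / 2 * ⟪e, u⟫ := hmin ⟨aux_ge he hu, aux_le_one he hu⟩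
  have h2 := real_inner_le_norm u (y - (zz q 0 / 2) • e)
  rw [mem_ball_iff_norm] at hy
  rw [hu, one_mul, inner_sub_right, inner_smul_right, real_inner_comm e u] at h2
  linarith

lemma KK_body (hq : 0 < q) (he : ‖e‖ = 1) : IsConvexBody0 (KK q e) :=
  ⟨KK_compact hq he, KK_convex, KK_interior hq he, KK_zero hq he⟩

def ff (n : ℕ) (p q : ℝ) (e u : EuclideanSpace ℝ (Fin n)) : ℝ :=
  (n : ℝ)⁻¹ * ((2 * q + sH ⟪e, u⟫ ^ q + sH ⟪e, u⟫ ^ (q + 2)) ^ (n - 2) *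
    (q + (q + 2) * sH ⟪e, u⟫ ^ 2) * ph q ⟪e, u⟫ ^ (1 - p))

lemma ff_cont (p : ℝ) (hq : 0 < q) (he : ‖e‖ = 1) :
    ContinuousOn (ff n p q e) (unitSphere n) := by
  have hin : Continuous (fun u : EuclideanSpace ℝ (Fin n) => ⟪e, u⟫) := by fun_prop
  have hs : Continuous (fun u : EuclideanSpace ℝ (Fin n) => sH ⟪e, u⟫) := sH_cont.comp hin
  have h1 : Continuous (fun u : EuclideanSpace ℝ (Fin n) => sH ⟪e, u⟫ ^ q) :=
    hs.rpow_const fun _ => Or.inr hq.le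
  have h2 : Continuous (fun u : EuclideanSpace ℝ (Fin n) => sH ⟪e, u⟫ ^ (q + 2)) :=
    hs.rpow_const fun _ => Or.inr (by linarith)
  have h3 : ContinuousOn (fun u : EuclideanSpace ℝ (Fin n) => ph q ⟪e, u⟫) (unitSphere n) := by
    refine (ph_cont hq).comp hin.continuousOn fun u hu => ?_
    have hu1 : ‖u‖ = 1 := by simpa [unitSphere] using hu
    exact ⟨aux_ge he hu1, aux_le_one he hu1⟩
  have h4 : ContinuousOn (fun u : EuclideanSpace ℝ (Fin n) => ph q ⟪e, u⟫ ^ (1 - p))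
      (unitSphere n) := by
    refine h3.rpow_const fun u hu => Or.inl ?_
    have hu1 : ‖u‖ = 1 := by simpa [unitSphere] using hu
    exact (ph_pos hq (aux_le_one he hu1)).ne'
  have h5 : Continuous (fun u : EuclideanSpace ℝ (Fin n) =>
      (2 * q + sH ⟪e, u⟫ ^ q + sH ⟪e, u⟫ ^ (q + 2)) ^ (n - 2) *
    (q + (q + 2) * sH ⟪e, u⟫ ^ 2)) := by fun_prop
  exact continuousOn_const.mul (h5.continuousOn.mul h4)

lemma ff_pos (hn : 2 ≤ n) (p : ℝ) (hq : 0 < q) (he : ‖e‖ = 1) :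
    ∀ u ∈ unitSphere n, 0 < ff n p q e u := by
  intro u hu
  have hu1 : ‖u‖ = 1 := by simpa [unitSphere] using hu
  have h1 := ph_pos hq (aux_le_one he hu1)
  have h2 : 0 ≤ sH ⟪e, u⟫ := Real.sqrt_nonneg _
  have hn0 : (0 : ℝ) < n := by exact_mod_cast (by omega : 0 < n)
  unfold ff
  positivity

lemma ff_eq (hn : 2 ≤ n) {p : ℝ} (hq : 0 < n + p - 2) (he : ‖e‖ = 1)
    {u : EuclideanSpace ℝ (Fin n)} (hu : ‖u‖ = 1) (hne : u ≠ -e) :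
    (n : ℝ) * ff n p (n + p - 2) e u * et (n + p - 2) ⟪e, u⟫ ^ (p - 1)
      = al (n + p - 2) ⟪e, u⟫ ^ (n - 2) * gg (n + p - 2) ⟪e, u⟫ := by
  have hc := aux_gt he hu hne
  have hs := sH_pos hc
  have hph := ph_pos hq (aux_le_one he hu)
  have hn0 : (n : ℝ) ≠ 0 := by exact_mod_cast (by omega : n ≠ 0)
  rw [al_mul hc, et_eq _ hc.le, Real.mul_rpow hs.le hph.le, ff, gg]
  have e1 : ph ((n : ℝ) + p - 2) ⟪e, u⟫ ^ (1 - p) * ph ((n : ℝ) + p - 2) ⟪e, u⟫ ^ (p - 1) = 1 := by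
    rw [← Real.rpow_add hph]; simp
  have e2 : sH ⟪e, u⟫ ^ ((n : ℝ) + p - 2 - 1) = sH ⟪e, u⟫ ^ (p - 1) * sH ⟪e, u⟫ ^ (n - 2) := by
    rw [← Real.rpow_natCast, ← Real.rpow_add hs, Nat.cast_sub hn]
    congr 1
    push_cast
    ring
  rw [e2, div_pow]
  generalize ph ((n : ℝ) + p - 2) ⟪e, u⟫ ^ (1 - p) = a at *
  generalize ph ((n : ℝ) + p - 2) ⟪e, u⟫ ^ (p - 1) = b at *
  generalize (2 * ((n : ℝ) + p - 2) + sH ⟪e, u⟫ ^ ((n : ℝ) + p - 2) +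
    sH ⟪e, u⟫ ^ ((n : ℝ) + p - 2 + 2)) ^ (n - 2) = d
  have h3 : sH ⟪e, u⟫ ^ (n - 2) ≠ 0 := (pow_pos hs _).ne'
  generalize sH ⟪e, u⟫ ^ (n - 2) = s at *
  generalize sH ⟪e, u⟫ ^ (p - 1) = t at *
  generalize (n : ℝ) + p - 2 + ((n : ℝ) + p - 2 + 2) * sH ⟪e, u⟫ ^ 2 = X
  calc (n : ℝ) * ((n : ℝ)⁻¹ * (d * X * a)) * (t * b)
      = ((n : ℝ) * (n : ℝ)⁻¹) * (a * b) * (d * X * t) := by ring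
    _ = (s * s⁻¹) * (d * X * t) := by rw [e1, mul_inv_cancel₀ hn0, mul_inv_cancel₀ h3, one_mul]
    _ = d / s * (t * s * X) := by rw [div_eq_mul_inv]; ring

lemma KK_sol (hn : 2 ≤ n) {p : ℝ} (hq : 0 < n + p - 2) (he : ‖e‖ = 1) :
    IsLpSolution p (ff n p (n + p - 2) e) (KK (n + p - 2) e) := by
  have hne : ∀ u, ‖u‖ = 1 → 0 < suppFn (KK ((n : ℝ) + p - 2) e) u → u ≠ -e := by
    rintro u hu h rfl
    rw [KK_suppFn hq he hu] at h
    simp [he, et_neg_one] at h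
  constructor
  · apply measure_mono_null (t := {-e})
    · rintro u ⟨hu, h⟩
      have hu1 : ‖u‖ = 1 := by simpa [unitSphere] using hu
      rw [KK_suppFn hq he hu1] at h
      by_contra hcon
      exact (et_pos hq (aux_gt he hu1 hcon) (aux_le_one he hu1)).ne' h
    · have : (0 : ℝ) < n - 1 := by
        have : (2 : ℝ) ≤ n := by exact_mod_cast hn
        linarith
      have := Measure.nullSingletonClass_hausdorff (EuclideanSpace ℝ (Fin n)) this
      exact measure_singleton _
  · intro ω hω hsub
    have hu1 : ∀ u ∈ ω, ‖u‖ = 1 := fun u hu => by simpa [unitSphere] using (hsub hu).1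
    have hu2 : ∀ u ∈ ω, u ≠ -e := fun u hu => hne u (hu1 u hu) (hsub hu).2
    have hun : ⋃ u ∈ ω, face (KK ((n : ℝ) + p - 2) e) u = GG ((n : ℝ) + p - 2) e '' ω := by
      rw [← biUnion_of_singleton (GG ((n : ℝ) + p - 2) e '' ω), biUnion_image]
      exact iUnion₂_congr fun u hu => KK_face hq he (hu1 u hu) (hu2 u hu)
    rw [surfMeas, hun, GG_area hn hq he ω hω fun u hu => ⟨hu1 u hu, hu2 u hu⟩]
    refine setLIntegral_congr_fun hω fun u hu => ?_
    rw [KK_suppFn hq he (hu1 u hu), ff_eq hn hq he (hu1 u hu) (hu2 u hu)]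

lemma face_sub (hq : 0 < q) (he : ‖e‖ = 1) :
    face (KK q e) (-e) ⊆ ((ℝ ∙ e)ᗮ : Submodule ℝ (EuclideanSpace ℝ (Fin n))) := by
  rintro z ⟨-, h⟩
  rw [KK_suppFn hq he (by simpa using he)] at h
  simp only [inner_neg_right, real_inner_self_eq_norm_sq, he, one_pow, et_neg_one,
    neg_eq_zero] at h
  rw [SetLike.mem_coe, Submodule.mem_orthogonal_singleton_iff_inner_left]
  exact h

lemma face_sup (hq : 0 < q) (he : ‖e‖ = 1) : ∃ r > 0, ∀ y : EuclideanSpace ℝ (Fin n),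
    y ∈ (ℝ ∙ e)ᗮ → ‖y‖ ≤ r → y ∈ face (KK q e) (-e) := by
  obtain ⟨c0, hc0, hmin⟩ := isCompact_Icc.exists_isMinOn ⟨(1 : ℝ), by norm_num⟩ (ph_cont hq)
  refine ⟨ph q c0, ph_pos hq hc0.2, fun y hy hyr => ?_⟩
  rw [Submodule.mem_orthogonal_singleton_iff_inner_right] at hy
  refine ⟨fun u hu => ?_, ?_⟩
  · have h1 := real_inner_le_norm (u - ⟪e, u⟫ • e) y
    rw [inner_sub_left, real_inner_smul_left, hy, aux_proj_norm he hu, mul_zero, sub_zero] at h1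
    refine h1.trans ?_
    rw [et_eq q (aux_ge he hu)]
    exact mul_le_mul sqrt_le_sH (hyr.trans (hmin ⟨aux_ge he hu, aux_le_one he hu⟩)) (norm_nonneg _)
      (Real.sqrt_nonneg _)
  · rw [KK_suppFn hq he (by simpa using he)]
    simp [he, et_neg_one, real_inner_comm e y, hy]

lemma face_span (hq : 0 < q) (he : ‖e‖ = 1) :
    affineSpan ℝ (face (KK q e) (-e)) = ((ℝ ∙ e)ᗮ).toAffineSubspace := by
  obtain ⟨r, hr, hs⟩ := face_sup hq he
  have h0 : (0 : EuclideanSpace ℝ (Fin n)) ∈ affineSpan ℝ (face (KK q e) (-e)) :=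
    subset_affineSpan ℝ _ (hs 0 (Submodule.zero_mem _) (by simpa using hr.le))
  apply le_antisymm
  · rw [affineSpan_le]
    intro x hx
    exact face_sub hq he hx
  · intro y hy
    have hy : y ∈ (ℝ ∙ e)ᗮ := hy
    by_cases hy0 : y = 0
    · rwa [hy0]
    have hp : 0 < ‖y‖ := norm_pos_iff.2 hy0
    have h1 := subset_affineSpan ℝ _ (hs ((r / ‖y‖) • y) (Submodule.smul_mem _ _ hy) (by
      rw [norm_smul, Real.norm_of_nonneg (by positivity), div_mul_cancel₀ _ hp.ne']))
    have h2 := AffineMap.lineMap_mem (‖y‖ / r) h0 h1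
    rw [AffineMap.lineMap_apply] at h2
    have h3 : (‖y‖ / r) • ((r / ‖y‖) • y -ᵥ (0 : EuclideanSpace ℝ (Fin n))) +ᵥ
        (0 : EuclideanSpace ℝ (Fin n)) = y := by
      simp only [vsub_eq_sub, sub_zero, vadd_eq_add, add_zero, smul_smul]
      rw [show ‖y‖ / r * (r / ‖y‖) = 1 by field_simp, one_smul]
    rwa [h3] at h2

lemma face_int (hq : 0 < q) (he : ‖e‖ = 1) :
    (0 : EuclideanSpace ℝ (Fin n)) ∈ intrinsicInterior ℝ (face (KK q e) (-e)) := by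
  obtain ⟨r, hr, hs⟩ := face_sup hq he
  have h0 : (0 : EuclideanSpace ℝ (Fin n)) ∈ affineSpan ℝ (face (KK q e) (-e)) :=
    subset_affineSpan ℝ _ (hs 0 (Submodule.zero_mem _) (by simpa using hr.le))
  rw [mem_intrinsicInterior]
  refine ⟨⟨0, h0⟩, ?_, rfl⟩
  rw [mem_interior_iff_mem_nhds]
  refine Filter.mem_of_superset (Metric.ball_mem_nhds _ hr) ?_
  rintro ⟨y, hy⟩ hyr
  have hy' : y ∈ (ℝ ∙ e)ᗮ := by
    rw [face_span hq he] at hy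
    exact hy
  refine hs y hy' ?_
  rw [Metric.mem_ball, Subtype.dist_eq, dist_zero_right] at hyr
  exact hyr.le

end final

/-- **Example 4.2.** For `2 - n < p < 1` there are `K ∈ 𝒦₀ⁿ` and a positive continuous
`f` on `S^{n-1}` such that `K` solves the `L_p` Minkowski problem `dS_{K,p} = f dH^{n-1}`
and `o` lies in the relative interior of an `(n-1)`-dimensional face of `K`. -/
theorem stmt16 {n : ℕ} (hn : 2 ≤ n) {p : ℝ} (hp1 : 2 - (n : ℝ) < p) (hp2 : p < 1) :
    ∃ (K : Set (EuclideanSpace ℝ (Fin n))) (f : EuclideanSpace ℝ (Fin n) → ℝ)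
      (u₀ : EuclideanSpace ℝ (Fin n)),
      IsConvexBody0 K ∧ ContinuousOn f (unitSphere n) ∧
      (∀ u ∈ unitSphere n, 0 < f u) ∧ IsLpSolution p f K ∧ u₀ ∈ unitSphere n ∧
      Module.finrank ℝ (affineSpan ℝ (face K u₀)).direction = n - 1 ∧
      (0 : EuclideanSpace ℝ (Fin n)) ∈ intrinsicInterior ℝ (face K u₀) := by
  have hq : 0 < (n : ℝ) + p - 2 := by linarith
  let e : EuclideanSpace ℝ (Fin n) := EuclideanSpace.single ⟨0, by omega⟩ 1
  have he : ‖e‖ = 1 := by simp [e]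
  have hme : ‖-e‖ = 1 := by rw [norm_neg, he]
  refine ⟨KK ((n : ℝ) + p - 2) e, ff n p ((n : ℝ) + p - 2) e, -e, KK_body hq he,
    ff_cont p hq he, ff_pos hn p hq he, KK_sol hn hq he, by simpa [unitSphere] using hme, ?_,
    face_int hq he⟩
  rw [face_span hq he, Submodule.toAffineSubspace_direction]
  exact aux_finrank e he
end
end

section
/- Let n ≥ 2, p < 1, and 0 < τ1 < τ2. Suppose f : S^{n-1} → ℝ satisfies τ1 < f(u) < τ2 for all u ∈ S^{n-1}, and K ∈ K_0^n is a solution of the L_p Minkowski problem dS_{K,p} = f dH^{n-1}. Then the support function h_K is differentiable at every point u₀ ∈ S^{n-1} \ N(K,o); equivalently, the face F(K,u₀) is a singleton for every such u₀. -/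
open MeasureTheory Set
open scoped ENNReal NNReal RealInnerProductSpace

noncomputable section

/-- abbreviation -/
abbrev EE (n : ℕ) := EuclideanSpace ℝ (Fin n)

theorem aux_bdd {n : ℕ} {K : Set (EE n)} (hK : IsCompact K) (u : EE n) :
    BddAbove ((fun y => ⟪u, y⟫) '' K) :=
  (hK.image (by fun_prop)).bddAbove

theorem aux_le_supp {n : ℕ} {K : Set (EE n)} (hK : IsCompact K) (u : EE n) {y : EE n}
    (hy : y ∈ K) : ⟪u, y⟫ ≤ suppFn K u :=
  le_csSup (aux_bdd hK u) ⟨y, hy, rfl⟩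

theorem aux_exists_max {n : ℕ} {K : Set (EE n)} (hK : IsCompact K) (hne : K.Nonempty) (u : EE n) :
    ∃ y ∈ K, suppFn K u = ⟪u, y⟫ ∧ ∀ x ∈ K, ⟪u, x⟫ ≤ ⟪u, y⟫ := by
  obtain ⟨y, hy, hm⟩ := hK.exists_isMaxOn hne (f := fun y => ⟪u, y⟫) (by fun_prop)
  refine ⟨y, hy, ?_, fun x hx => hm hx⟩
  apply le_antisymm
  · apply csSup_le (hne.image _)
    rintro _ ⟨x, hx, rfl⟩
    exact hm hx
  · exact aux_le_supp hK u hy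

theorem aux_mem_face {n : ℕ} {K : Set (EE n)} (hK : IsCompact K) {u x : EE n} :
    x ∈ face K u ↔ x ∈ K ∧ ∀ y ∈ K, ⟪u, y⟫ ≤ ⟪u, x⟫ := by
  constructor
  · rintro ⟨hx, h⟩
    refine ⟨hx, fun y hy => ?_⟩
    rw [real_inner_comm x u, h]
    exact aux_le_supp hK u hy
  · rintro ⟨hx, h⟩
    refine ⟨hx, ?_⟩
    rw [real_inner_comm]
    apply le_antisymm (aux_le_supp hK u hx)
    obtain ⟨y, hy, h1, _⟩ := aux_exists_max hK ⟨x, hx⟩ u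
    rw [h1]; exact h y hy

theorem aux_face_nonempty {n : ℕ} {K : Set (EE n)} (hK : IsCompact K) (hne : K.Nonempty)
    (u : EE n) : (face K u).Nonempty := by
  obtain ⟨y, hy, h1, h2⟩ := aux_exists_max hK hne u
  exact ⟨y, (aux_mem_face hK).2 ⟨hy, h2⟩⟩

theorem aux_face_smul {n : ℕ} {K : Set (EE n)} (hK : IsCompact K) {t : ℝ} (ht : 0 < t) (u : EE n) :
    face K (t • u) = face K u := by
  ext x
  rw [aux_mem_face hK, aux_mem_face hK]
  simp only [inner_smul_left, RCLike.conj_to_real]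
  refine and_congr_right fun _ => forall₂_congr fun y _ => ?_
  exact mul_le_mul_iff_right₀ ht

theorem aux_supp_smul {n : ℕ} {K : Set (EE n)} (hK : IsCompact K) (hne : K.Nonempty)
    {t : ℝ} (ht : 0 < t) (u : EE n) : suppFn K (t • u) = t * suppFn K u := by
  obtain ⟨x, hx⟩ := aux_face_nonempty hK hne u
  have h1 := hx
  rw [← aux_face_smul hK ht] at h1
  rw [← hx.2, ← h1.2, inner_smul_right]

theorem aux_supp_cont {n : ℕ} {K : Set (EE n)} (hK : IsCompact K) (hne : K.Nonempty) :
    Continuous (suppFn K) := by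
  obtain ⟨R, hR⟩ := hK.isBounded.exists_norm_le
  have hR0 : 0 ≤ R := (norm_nonneg _).trans (hR _ hne.some_mem)
  have key : ∀ u v : EE n, suppFn K u - suppFn K v ≤ R * ‖u - v‖ := by
    intro u v
    obtain ⟨y, hy, h1, _⟩ := aux_exists_max hK hne u
    have h2 := aux_le_supp hK v hy
    have h3 : ⟪u - v, y⟫ ≤ ‖u - v‖ * ‖y‖ := real_inner_le_norm _ _
    rw [inner_sub_left] at h3
    have := mul_le_mul_of_nonneg_left (hR y hy) (norm_nonneg (u - v))
    nlinarith
  have : LipschitzWith ⟨R, hR0⟩ (suppFn K) := by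
    apply LipschitzWith.of_dist_le_mul
    intro u v
    rw [dist_eq_norm, dist_eq_norm, Real.norm_eq_abs, abs_le]
    have h1 := key u v
    have h2 := key v u
    rw [norm_sub_rev] at h2
    constructor
    · change -(R * ‖u - v‖) ≤ _
      linarith
    · exact h1
  exact this.continuous

/-- compactness lemma: near-maximizers are close to the face -/
theorem aux_near_face {n : ℕ} {K : Set (EE n)} (hK : IsCompact K) {u z : EE n}
    (hz : ∀ x ∈ K, ⟪u, x - z⟫ ≤ 0) {ψ : EE n → ℝ} (hψ : Continuous ψ)
    (hF : ∀ x ∈ K, ⟪u, x - z⟫ = 0 → ψ x ≤ 0) {η : ℝ} (hη : 0 < η) :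
    ∃ ε > 0, ∀ x ∈ K, -ε ≤ ⟪u, x - z⟫ → ψ x < η := by
  by_cases hne : (K ∩ {x | η ≤ ψ x}).Nonempty
  · have hc : IsCompact (K ∩ {x | η ≤ ψ x}) := hK.inter_right (isClosed_le continuous_const hψ)
    obtain ⟨y, hy, hm⟩ := hc.exists_isMaxOn hne (f := fun x => ⟪u, x - z⟫) (by fun_prop)
    have hlt : ⟪u, y - z⟫ < 0 := by
      refine lt_of_le_of_ne (hz y hy.1) fun h => ?_
      have := hF y hy.1 h
      have h2 : η ≤ ψ y := hy.2
      linarith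
    refine ⟨-⟪u, y - z⟫ / 2, by linarith, fun x hx h => ?_⟩
    by_contra hcon
    push Not at hcon
    have : ⟪u, x - z⟫ ≤ ⟪u, y - z⟫ := hm ⟨hx, hcon⟩
    linarith
  · refine ⟨1, one_pos, fun x hx _ => ?_⟩
    by_contra hcon
    push Not at hcon
    exact hne ⟨x, hx, hcon⟩

theorem aux_diff {n : ℕ} {K : Set (EE n)} (hK : IsCompact K) {u₀ z : EE n}
    (hz : face K u₀ = {z}) : DifferentiableAt ℝ (suppFn K) u₀ := by
  have hzF : z ∈ face K u₀ := by rw [hz]; rfl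
  have hzK : z ∈ K := hzF.1
  have hzm := ((aux_mem_face hK).1 hzF).2
  obtain ⟨R, hR⟩ := hK.isBounded.exists_norm_le
  have hR0 : 0 ≤ R := (norm_nonneg _).trans (hR _ hzK)
  have : HasFDerivAt (suppFn K) (innerSL ℝ z) u₀ := by
    rw [hasFDerivAt_iff_isLittleO_nhds_zero, Asymptotics.isLittleO_iff]
    intro c hc
    obtain ⟨ε, hε, hε2⟩ := aux_near_face hK (u := u₀) (z := z)
      (fun x hx => by rw [inner_sub_right]; linarith [hzm x hx])
      (ψ := fun x => ‖x - z‖) (by fun_prop) (fun x hx h => by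
        have : x ∈ face K u₀ := (aux_mem_face hK).2 ⟨hx, fun y hy => by
          rw [inner_sub_right] at h; linarith [hzm y hy]⟩
        rw [hz] at this
        rw [mem_singleton_iff] at this
        simp [this]) hc
    have hpos : 0 < ε / (2 * R + 1) := by positivity
    filter_upwards [Metric.ball_mem_nhds (0 : EE n) hpos] with w hw
    rw [mem_ball_zero_iff] at hw
    obtain ⟨x, hx, h1, h2⟩ := aux_exists_max hK ⟨z, hzK⟩ (u₀ + w)
    have h3 := h2 z hzK
    have hs : suppFn K u₀ = ⟪u₀, z⟫ := by rw [← hzF.2, real_inner_comm]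
    have hxz : ‖x - z‖ ≤ 2 * R := by
      have := norm_sub_le x z
      linarith [hR x hx, hR z hzK]
    have hb : |⟪w, x - z⟫| ≤ ‖w‖ * ‖x - z‖ := abs_real_inner_le_norm _ _
    have h4 : ‖x - z‖ < c := by
      apply hε2 x hx
      rw [lt_div_iff₀ (by positivity)] at hw
      rw [inner_add_left, inner_add_left] at h3
      rw [inner_sub_right] at hb ⊢
      have := (abs_le.1 hb).2
      have := mul_le_mul_of_nonneg_left hxz (norm_nonneg w)
      have := norm_nonneg w
      nlinarith
    have h5 := hzm x hx
    rw [Real.norm_eq_abs, h1, hs, innerSL_apply_apply, abs_le]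
    rw [inner_sub_right] at hb
    have hb' := abs_le.1 hb
    simp only [inner_add_left] at h3 ⊢
    rw [real_inner_comm w z]
    have := mul_le_mul_of_nonneg_left h4.le (norm_nonneg w)
    have : 0 ≤ c * ‖w‖ := by positivity
    constructor <;> nlinarith
  exact this.differentiableAt

/-- relational Lipschitz estimate for the Hausdorff measure -/
theorem aux_haus_rel {n : ℕ} {d : ℝ} (hd : 0 ≤ d) {s t : Set (EE n)} (R : (EE n) → (EE n) → Prop)
    {L : ℝ} (hR : ∀ a b a' b', R a b → R a' b' → ‖b - b'‖ ≤ L * ‖a - a'‖)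
    (h : ∀ b ∈ t, ∃ a ∈ s, R a b) : μH[d] t ≤ (ENNReal.ofReal L) ^ d * μH[d] s := by
  choose! g hg using h
  have hanti : AntilipschitzWith L.toNNReal (fun b : t => g b.1) := by
    apply AntilipschitzWith.of_le_mul_dist
    intro b b'
    have := hR _ _ _ _ (hg b.1 b.2).2 (hg b'.1 b'.2).2
    rw [Subtype.dist_eq, dist_eq_norm, dist_eq_norm]
    refine this.trans (mul_le_mul_of_nonneg_right (Real.le_coe_toNNReal L) (norm_nonneg _))
  have h1 := hanti.le_hausdorffMeasure_image hd univ
  have h2 := (isometry_subtype_coe (s := t)).hausdorffMeasure_image (d := d) (Or.inl hd) univ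
  rw [image_univ, Subtype.range_coe] at h2
  rw [h2]
  refine h1.trans ?_
  rw [ENNReal.ofReal]
  gcongr
  rintro _ ⟨b, _, rfl⟩
  exact (hg b.1 b.2).1

theorem aux_pack {n : ℕ} {d : ℝ} (hd : 0 ≤ d) {G P : Set (EE n)} (hG : IsCompact G) (N : ℕ)
    {a B : ℝ} (ha : 0 < a) (w t : EE n) (hP : ∀ g ∈ G, ∀ j < N, a • g + (j : ℝ) • w ∈ P)
    (hB : ∀ g ∈ G, |⟪g, t⟫| ≤ B) (hw : 2 * a * B < ⟪w, t⟫) :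
    (N : ℝ≥0∞) * (ENNReal.ofReal a ^ d * μH[d] G) ≤ μH[d] P := by
  let T : ℕ → Set (EE n) := fun j => (fun g => a • g + (j : ℝ) • w) '' G
  have hTm : ∀ j, MeasurableSet (T j) := fun j =>
    (hG.image (by fun_prop)).isClosed.measurableSet
  have hTG : ∀ j, ENNReal.ofReal a ^ d * μH[d] G ≤ μH[d] (T j) := by
    intro j
    have h1 : μH[d] G ≤ ENNReal.ofReal (1 / a) ^ d * μH[d] (T j) := by
      apply aux_haus_rel hd (fun x g => x = a • g + (j : ℝ) • w)
      · rintro x g x' g' rfl rfl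
        rw [add_sub_add_right_eq_sub, ← smul_sub, norm_smul, Real.norm_of_nonneg ha.le]
        apply le_of_eq; field_simp
      · intro g hg
        exact ⟨_, ⟨g, hg, rfl⟩, rfl⟩
    calc ENNReal.ofReal a ^ d * μH[d] G
        ≤ ENNReal.ofReal a ^ d * (ENNReal.ofReal (1 / a) ^ d * μH[d] (T j)) := by gcongr
      _ = μH[d] (T j) := by
        rw [← mul_assoc, ← ENNReal.mul_rpow_of_nonneg _ _ hd, ← ENNReal.ofReal_mul ha.le,
          mul_one_div_cancel ha.ne']
        simp
  have hdisj : Pairwise (Function.onFun Disjoint T) := by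
    have key : ∀ i j : ℕ, i < j → Disjoint (T i) (T j) := by
      intro i j hij
      rw [Set.disjoint_left]
      rintro _ ⟨g, hg, rfl⟩ ⟨g', hg', he⟩
      have h1 := congrArg (fun x => ⟪x, t⟫) he
      simp only [inner_add_left, inner_smul_left, RCLike.conj_to_real] at h1
      have h2 := abs_le.1 (hB g hg)
      have h3 := abs_le.1 (hB g' hg')
      have hB0 : 0 ≤ B := (abs_nonneg _).trans (hB g hg)
      have hw0 : 0 < ⟪w, t⟫ := lt_of_le_of_lt (by positivity) hw
      have hij' : (i : ℝ) + 1 ≤ j := by exact_mod_cast hij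
      nlinarith
    intro i j hij
    rcases lt_or_gt_of_ne hij with h | h
    · exact key i j h
    · exact (key j i h).symm
  calc (N : ℝ≥0∞) * (ENNReal.ofReal a ^ d * μH[d] G)
      = ∑ j ∈ Finset.range N, ENNReal.ofReal a ^ d * μH[d] G := by simp
    _ ≤ ∑ j ∈ Finset.range N, μH[d] (T j) := Finset.sum_le_sum fun j _ => hTG j
    _ = μH[d] (⋃ j ∈ Finset.range N, T j) := by
        rw [measure_biUnion_finset]
        · intro i _ j _ hij; exact hdisj hij
        · intro j _; exact hTm j
    _ ≤ μH[d] P := by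
        apply measure_mono
        intro x hx
        simp only [mem_iUnion, Finset.mem_range] at hx
        obtain ⟨j, hj, g, hg, rfl⟩ := hx
        exact hP g hg j hj

/-- orthogonal projection along `e` -/
def prj {n : ℕ} (e : EE n) : EE n →L[ℝ] EE n := (Submodule.span ℝ {e})ᗮ.starProjection

theorem prj_norm {n : ℕ} (e x : EE n) : ‖prj e x‖ ≤ ‖x‖ :=
  Submodule.norm_starProjection_apply_le _ _

theorem prj_self {n : ℕ} (e : EE n) : prj e e = 0 := by
  apply Submodule.starProjection_orthogonal_apply_eq_zero
  exact Submodule.mem_span_singleton_self e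

theorem prj_mem {n : ℕ} (e x : EE n) : prj e x ∈ (Submodule.span ℝ {e})ᗮ :=
  Submodule.starProjection_apply_mem _ _

theorem prj_fix {n : ℕ} {e x : EE n} (hx : x ∈ (Submodule.span ℝ {e})ᗮ) : prj e x = x :=
  Submodule.starProjection_eq_self_iff.2 hx

theorem prj_decomp {n : ℕ} (e x : EE n) : ∃ s : ℝ, x = prj e x + s • e := by
  have h : x - prj e x ∈ (Submodule.span ℝ {e}) := by
    have := Submodule.sub_starProjection_mem_orthogonal (K := (Submodule.span ℝ {e})ᗮ) x
    rwa [Submodule.orthogonal_orthogonal] at this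
  obtain ⟨s, hs⟩ := Submodule.mem_span_singleton.1 h
  exact ⟨s, by rw [hs]; abel⟩

theorem aux_surf_upper {n : ℕ} {p τ1 τ2 : ℝ} (hp : p < 1) (hτ1 : 0 < τ1)
    {f : EE n → ℝ} (hf : ∀ u ∈ unitSphere n, τ1 < f u ∧ f u < τ2)
    {K : Set (EE n)} (hsol : IsLpSolution p f K) {ω : Set (EE n)} (hm : MeasurableSet ω)
    (hω : ω ⊆ unitSphere n) {c : ℝ} (hc : 0 < c) (hcω : ∀ u ∈ ω, c ≤ suppFn K u) :
    μH[(n : ℝ) - 1] (⋃ u ∈ ω, face K u)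
      ≤ ENNReal.ofReal (n * τ2 * c ^ (p - 1)) * μH[(n : ℝ) - 1] ω := by
  have h := hsol.2 ω hm (fun u hu => ⟨hω hu, hc.trans_le (hcω u hu)⟩)
  rw [surfMeas] at h
  rw [h, ← setLIntegral_const]
  apply setLIntegral_mono' hm
  intro u hu
  apply ENNReal.ofReal_le_ofReal
  have h1 := hf u (hω hu)
  have h2 : suppFn K u ^ (p - 1) ≤ c ^ (p - 1) :=
    Real.rpow_le_rpow_of_nonpos hc (hcω u hu) (by linarith)
  have h3 : 0 ≤ suppFn K u ^ (p - 1) := Real.rpow_nonneg (hc.le.trans (hcω u hu)) _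
  have h4 : 0 ≤ τ2 := by linarith
  have h5 := h1.2.le
  gcongr

theorem aux_surf_lower {n : ℕ} {p τ1 τ2 : ℝ} (hp : p < 1) (hτ1 : 0 < τ1)
    {f : EE n → ℝ} (hf : ∀ u ∈ unitSphere n, τ1 < f u ∧ f u < τ2)
    {K : Set (EE n)} (hsol : IsLpSolution p f K) {ω : Set (EE n)} (hm : MeasurableSet ω)
    (hω : ω ⊆ unitSphere n) {M : ℝ} (hpos : ∀ u ∈ ω, 0 < suppFn K u)
    (hM : ∀ u ∈ ω, suppFn K u ≤ M) :
    ENNReal.ofReal (n * τ1 * M ^ (p - 1)) * μH[(n : ℝ) - 1] ω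
      ≤ μH[(n : ℝ) - 1] (⋃ u ∈ ω, face K u) := by
  have h := hsol.2 ω hm (fun u hu => ⟨hω hu, hpos u hu⟩)
  rw [surfMeas] at h
  rw [h, ← setLIntegral_const]
  apply setLIntegral_mono' hm
  intro u hu
  apply ENNReal.ofReal_le_ofReal
  have h1 := hf u (hω hu)
  have h2 : M ^ (p - 1) ≤ suppFn K u ^ (p - 1) :=
    Real.rpow_le_rpow_of_nonpos (hpos u hu) (hM u hu) (by linarith)
  have h3 : 0 ≤ M ^ (p - 1) := Real.rpow_nonneg ((hpos u hu).le.trans (hM u hu)) _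
  have h4 : 0 ≤ f u := by linarith
  have h5 := h1.1.le
  gcongr

theorem aux_normalize {n : ℕ} {e a a' : EE n} (ha : ⟪a, e⟫ = 1) (ha' : ⟪a', e⟫ = 1) :
    ‖‖a‖⁻¹ • a - ‖a'‖⁻¹ • a'‖ ≤ 2 * ‖e‖ * ‖a - a'‖ := by
  have h1 : 1 ≤ ‖a‖ * ‖e‖ := ha ▸ real_inner_le_norm a e
  have h1' : 1 ≤ ‖a'‖ * ‖e‖ := ha' ▸ real_inner_le_norm a' e
  have h0 : 0 < ‖a‖ := by
    by_contra h
    have : ‖a‖ = 0 := le_antisymm (not_lt.1 h) (norm_nonneg _)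
    rw [this] at h1; linarith
  have h0' : 0 < ‖a'‖ := by
    by_contra h
    have : ‖a'‖ = 0 := le_antisymm (not_lt.1 h) (norm_nonneg _)
    rw [this] at h1'; linarith
  have h2 : ‖a‖⁻¹ • a - ‖a'‖⁻¹ • a' = ‖a‖⁻¹ • (a - a') + (‖a‖⁻¹ - ‖a'‖⁻¹) • a' := by
    module
  have h3 : ‖a‖⁻¹ ≤ ‖e‖ := by
    rw [inv_le_iff_one_le_mul₀ h0]; linarith
  have h4 : ‖(‖a‖⁻¹ - ‖a'‖⁻¹) • a'‖ = ‖a‖⁻¹ * |‖a'‖ - ‖a‖| := by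
    rw [norm_smul, Real.norm_eq_abs]
    have : ‖a‖⁻¹ - ‖a'‖⁻¹ = (‖a'‖ - ‖a‖) * ‖a‖⁻¹ * ‖a'‖⁻¹ := by field_simp
    rw [this, abs_mul, abs_mul, abs_of_pos (inv_pos.2 h0), abs_of_pos (inv_pos.2 h0')]
    field_simp
  have h5 : |‖a'‖ - ‖a‖| ≤ ‖a - a'‖ := by
    rw [norm_sub_rev]; exact abs_norm_sub_norm_le a' a
  rw [h2]
  refine (norm_add_le _ _).trans ?_
  rw [h4, norm_smul, norm_inv, norm_norm]
  have h6 : ‖a‖⁻¹ * |‖a'‖ - ‖a‖| ≤ ‖e‖ * ‖a - a'‖ := by gcongr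
  have h7 : ‖a‖⁻¹ * ‖a - a'‖ ≤ ‖e‖ * ‖a - a'‖ := by gcongr
  linarith

/-- the set of unit vectors in directions `v + g` -/
def dirs {n : ℕ} (v : EE n) (G : Set (EE n)) : Set (EE n) := (fun g => ‖v + g‖⁻¹ • (v + g)) '' G

theorem aux_ne {n : ℕ} {e v g : EE n} (hve : ⟪v, e⟫ = 1) (hg : ⟪g, e⟫ = 0) : 0 < ‖v + g‖ := by
  rw [norm_pos_iff]
  intro h
  have : ⟪v + g, e⟫ = 1 := by rw [inner_add_left, hve, hg]; simp
  rw [h, inner_zero_left] at this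
  norm_num at this

theorem dirs_sphere {n : ℕ} {e v : EE n} {G : Set (EE n)} (hve : ⟪v, e⟫ = 1)
    (hGe : ∀ g ∈ G, ⟪g, e⟫ = 0) : dirs v G ⊆ unitSphere n := by
  rintro _ ⟨g, hg, rfl⟩
  have := aux_ne hve (hGe g hg)
  simp only [unitSphere, mem_sphere_zero_iff_norm, norm_smul, norm_inv, norm_norm]
  exact inv_mul_cancel₀ this.ne'

theorem dirs_compact {n : ℕ} {e v : EE n} {G : Set (EE n)} (hG : IsCompact G) (hve : ⟪v, e⟫ = 1)
    (hGe : ∀ g ∈ G, ⟪g, e⟫ = 0) : IsCompact (dirs v G) := by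
  apply hG.image_of_continuousOn
  apply ContinuousOn.fun_smul
  · apply ContinuousOn.inv₀ (by fun_prop)
    intro g hg
    exact (aux_ne hve (hGe g hg)).ne'
  · fun_prop

theorem meas1 {n : ℕ} (hn : 2 ≤ n) {p τ1 τ2 : ℝ} (hp : p < 1) (hτ1 : 0 < τ1)
    {f : EE n → ℝ} (hf : ∀ u ∈ unitSphere n, τ1 < f u ∧ f u < τ2)
    {K : Set (EE n)} (hK : IsCompact K) (hne : K.Nonempty) (hsol : IsLpSolution p f K)
    {e v : EE n} (hve : ⟪v, e⟫ = 1) {G Cp : Set (EE n)} (hG : IsCompact G)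
    (hGe : ∀ g ∈ G, ⟪g, e⟫ = 0) {L c0 κ : ℝ} (hL : 0 < L) (hc0 : 0 < c0) (hκ : 0 < κ)
    (hGL : ∀ g ∈ G, ‖v + g‖ ≤ L) (hGc : ∀ g ∈ G, c0 ≤ suppFn K (v + g)) (c : EE n)
    (hGx : ∀ x ∈ Cp, ∃ s : ℝ, ∃ g ∈ G, c + κ • x + s • e ∈ face K (v + g)) :
    μH[(n : ℝ) - 1] (prj e '' Cp) ≤ ENNReal.ofReal (1 / κ) ^ ((n : ℝ) - 1) *
      (ENNReal.ofReal (n * τ2 * (c0 / L) ^ (p - 1)) *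
        (ENNReal.ofReal (2 * ‖e‖) ^ ((n : ℝ) - 1) * μH[(n : ℝ) - 1] G)) := by
  have hd : (0 : ℝ) ≤ (n : ℝ) - 1 := by
    have : (2 : ℝ) ≤ n := by exact_mod_cast hn
    linarith
  have hface : ∀ g ∈ G, face K (‖v + g‖⁻¹ • (v + g)) = face K (v + g) := fun g hg =>
    aux_face_smul hK (inv_pos.2 (aux_ne hve (hGe g hg))) _
  have s1 : μH[(n : ℝ) - 1] (dirs v G) ≤
      ENNReal.ofReal (2 * ‖e‖) ^ ((n : ℝ) - 1) * μH[(n : ℝ) - 1] G := by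
    apply aux_haus_rel hd (fun g u => ⟪g, e⟫ = 0 ∧ u = ‖v + g‖⁻¹ • (v + g))
    · rintro g u g' u' ⟨hg, rfl⟩ ⟨hg', rfl⟩
      have := aux_normalize (e := e) (a := v + g) (a' := v + g')
        (by rw [inner_add_left, hve, hg, add_zero]) (by rw [inner_add_left, hve, hg', add_zero])
      rwa [add_sub_add_left_eq_sub] at this
    · rintro _ ⟨g, hg, rfl⟩
      exact ⟨g, hg, hGe g hg, rfl⟩
  have s2 := aux_surf_upper hp hτ1 hf hsol (dirs_compact hG hve hGe).isClosed.measurableSet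
    (dirs_sphere hve hGe) (c := c0 / L) (by positivity) (by
      rintro _ ⟨g, hg, rfl⟩
      have h0 := aux_ne hve (hGe g hg)
      rw [aux_supp_smul hK hne (inv_pos.2 h0), div_eq_inv_mul]
      have := hGL g hg
      have := hGc g hg
      gcongr)
  have s3 : μH[(n : ℝ) - 1] (prj e '' Cp) ≤ ENNReal.ofReal (1 / κ) ^ ((n : ℝ) - 1) *
      μH[(n : ℝ) - 1] (⋃ u ∈ dirs v G, face K u) := by
    apply aux_haus_rel hd (fun y b => b = (1 / κ) • prj e (y - c))
    · rintro y b y' b' rfl rfl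
      rw [← smul_sub, ← map_sub, sub_sub_sub_cancel_right, norm_smul,
        Real.norm_of_nonneg (by positivity)]
      have := prj_norm e (y - y')
      gcongr
    · rintro _ ⟨x, hx, rfl⟩
      obtain ⟨s, g, hg, hf⟩ := hGx x hx
      refine ⟨c + κ • x + s • e, ?_, ?_⟩
      · simp only [mem_iUnion]
        refine ⟨_, ⟨g, hg, rfl⟩, ?_⟩
        rwa [hface g hg]
      · have : c + κ • x + s • e - c = κ • x + s • e := by abel
        rw [this, map_add, map_smul, map_smul, prj_self, smul_zero, add_zero, smul_smul,
          one_div, inv_mul_cancel₀ hκ.ne', one_smul]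
  refine s3.trans ?_
  gcongr
  exact s2.trans (by gcongr)

theorem meas2 {n : ℕ} (hn : 2 ≤ n) {p τ1 τ2 : ℝ} (hp : p < 1) (hτ1 : 0 < τ1)
    {f : EE n → ℝ} (hf : ∀ u ∈ unitSphere n, τ1 < f u ∧ f u < τ2)
    {K : Set (EE n)} (hK : IsCompact K) (h0K : (0 : EE n) ∈ K) (hsol : IsLpSolution p f K)
    {M : ℝ} (hM : ∀ x ∈ K, ‖x‖ ≤ M)
    {e v : EE n} (hve : ⟪v, e⟫ = 1) {P Cp : Set (EE n)} (hP : IsCompact P)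
    (hPe : ∀ g ∈ P, ⟪g, e⟫ = 0) {L : ℝ} (hL : 0 < L)
    (hPL : ∀ g ∈ P, ‖v + g‖ ≤ L)
    (hPx : ∀ g ∈ P, ∀ x ∈ face K (v + g), x ∈ Cp) :
    ENNReal.ofReal (n * τ1 * M ^ (p - 1)) * μH[(n : ℝ) - 1] P ≤
      ENNReal.ofReal (L + L ^ 2 * ‖e‖) ^ ((n : ℝ) - 1) *
      (ENNReal.ofReal (1 + L * ‖e‖) ^ ((n : ℝ) - 1) * μH[(n : ℝ) - 1] (prj e '' Cp)) := by
  have hd : (0 : ℝ) ≤ (n : ℝ) - 1 := by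
    have : (2 : ℝ) ≤ n := by exact_mod_cast hn
    linarith
  have hne : K.Nonempty := ⟨0, h0K⟩
  have hface : ∀ g ∈ P, face K (‖v + g‖⁻¹ • (v + g)) = face K (v + g) := fun g hg =>
    aux_face_smul hK (inv_pos.2 (aux_ne hve (hPe g hg))) _
  have s1 : μH[(n : ℝ) - 1] P ≤
      ENNReal.ofReal (L + L ^ 2 * ‖e‖) ^ ((n : ℝ) - 1) * μH[(n : ℝ) - 1] (dirs v P) := by
    apply aux_haus_rel hd (fun u g => 1 / L ≤ ⟪u, e⟫ ∧ ‖u‖ = 1 ∧ g = (⟪u, e⟫)⁻¹ • u - v)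
    · rintro u g u' g' ⟨hu, hu1, rfl⟩ ⟨hu', hu1', rfl⟩
      have hpos : 0 < ⟪u, e⟫ := lt_of_lt_of_le (by positivity) hu
      have hpos' : 0 < ⟪u', e⟫ := lt_of_lt_of_le (by positivity) hu'
      have hi : (⟪u, e⟫)⁻¹ ≤ L := by
        rw [inv_le_comm₀ hpos hL, ← one_div]; exact hu
      have hi' : (⟪u', e⟫)⁻¹ ≤ L := by
        rw [inv_le_comm₀ hpos' hL, ← one_div]; exact hu'
      have h2 : (⟪u, e⟫)⁻¹ • u - v - ((⟪u', e⟫)⁻¹ • u' - v) =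
          (⟪u, e⟫)⁻¹ • (u - u') + ((⟪u, e⟫)⁻¹ - (⟪u', e⟫)⁻¹) • u' := by module
      have h3 : (⟪u, e⟫)⁻¹ - (⟪u', e⟫)⁻¹ = (⟪u, e⟫)⁻¹ * (⟪u', e⟫)⁻¹ * ⟪u' - u, e⟫ := by
        rw [inner_sub_left]; field_simp
      have h4 : |⟪u' - u, e⟫| ≤ ‖u - u'‖ * ‖e‖ := by
        rw [norm_sub_rev]; exact abs_real_inner_le_norm _ _
      rw [h2]
      refine (norm_add_le _ _).trans ?_
      rw [norm_smul, norm_smul, hu1', mul_one, h3, Real.norm_eq_abs, Real.norm_eq_abs,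
        abs_mul, abs_mul, abs_of_pos (inv_pos.2 hpos), abs_of_pos (inv_pos.2 hpos')]
      have h5 : (⟪u, e⟫)⁻¹ * ‖u - u'‖ ≤ L * ‖u - u'‖ := by gcongr
      have h6 : (⟪u, e⟫)⁻¹ * (⟪u', e⟫)⁻¹ * |⟪u' - u, e⟫| ≤ L * L * (‖u - u'‖ * ‖e‖) := by
        gcongr
      nlinarith
    · intro g hg
      have h0 := aux_ne hve (hPe g hg)
      have h1 : ⟪‖v + g‖⁻¹ • (v + g), e⟫ = ‖v + g‖⁻¹ := by
        rw [inner_smul_left, inner_add_left, hve, hPe g hg]; simp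
      refine ⟨_, ⟨g, hg, rfl⟩, ?_, ?_, ?_⟩
      · simp only [h1]
        rw [one_div]
        have := hPL g hg
        gcongr
      · simp only [norm_smul, norm_inv, norm_norm]
        exact inv_mul_cancel₀ h0.ne'
      · simp only [h1]
        rw [inv_inv, smul_smul, mul_inv_cancel₀ h0.ne', one_smul]; abel
  set ω := dirs v P ∩ {u | 0 < suppFn K u} with hω
  have hωm : MeasurableSet ω := (dirs_compact hP hve hPe).isClosed.measurableSet.inter
    (isOpen_lt continuous_const (aux_supp_cont hK hne)).measurableSet
  have s2 : μH[(n : ℝ) - 1] (dirs v P) ≤ μH[(n : ℝ) - 1] ω := by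
    have hsub : dirs v P ⊆ {u ∈ unitSphere n | suppFn K u = 0} ∪ ω := by
      intro u hu
      have h1 : 0 ≤ suppFn K u := by simpa using aux_le_supp hK u h0K
      rcases h1.eq_or_lt with h | h
      · exact Or.inl ⟨dirs_sphere hve hPe hu, h.symm⟩
      · exact Or.inr ⟨hu, h⟩
    refine (measure_mono hsub).trans ((measure_union_le _ _).trans ?_)
    rw [hsol.1, zero_add]
  have s3 := aux_surf_lower hp hτ1 hf hsol hωm (fun u hu => dirs_sphere hve hPe hu.1) (M := M)
    (fun u hu => hu.2) (by
      intro u hu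
      have hu1 : ‖u‖ = 1 := by simpa [unitSphere] using dirs_sphere hve hPe hu.1
      obtain ⟨y, hy, h1, _⟩ := aux_exists_max hK hne u
      rw [h1]
      have := real_inner_le_norm u y
      rw [hu1, one_mul] at this
      exact this.trans (hM y hy))
  have s4 : μH[(n : ℝ) - 1] (⋃ u ∈ ω, face K u) ≤
      ENNReal.ofReal (1 + L * ‖e‖) ^ ((n : ℝ) - 1) * μH[(n : ℝ) - 1] (prj e '' Cp) := by
    apply aux_haus_rel hd (fun b y => b = prj e y ∧ ∃ g ∈ P, y ∈ face K (v + g))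
    · rintro b y b' y' ⟨rfl, g, hg, hy⟩ ⟨rfl, g', hg', hy'⟩
      rw [aux_mem_face hK] at hy hy'
      obtain ⟨s, hs⟩ := prj_decomp e (y - y')
      have hn1 : ⟪v + g, e⟫ = 1 := by rw [inner_add_left, hve, hPe g hg, add_zero]
      have hn1' : ⟪v + g', e⟫ = 1 := by rw [inner_add_left, hve, hPe g' hg', add_zero]
      have a1 : 0 ≤ ⟪v + g, y - y'⟫ := by rw [inner_sub_right]; linarith [hy.2 y' hy'.1]
      have a2 : ⟪v + g', y - y'⟫ ≤ 0 := by rw [inner_sub_right]; linarith [hy'.2 y hy.1]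
      rw [hs, inner_add_right, inner_smul_right] at a1 a2
      rw [hn1] at a1
      rw [hn1'] at a2
      have b1 := abs_le.1 (abs_real_inner_le_norm (v + g) (prj e (y - y')))
      have b2 := abs_le.1 (abs_real_inner_le_norm (v + g') (prj e (y - y')))
      have c1 := mul_le_mul_of_nonneg_right (hPL g hg) (norm_nonneg (prj e (y - y')))
      have c2 := mul_le_mul_of_nonneg_right (hPL g' hg') (norm_nonneg (prj e (y - y')))
      have hsabs : |s| ≤ L * ‖prj e (y - y')‖ := abs_le.2 ⟨by linarith, by linarith⟩
      rw [← map_sub]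
      calc ‖y - y'‖ = ‖prj e (y - y') + s • e‖ := by rw [← hs]
        _ ≤ ‖prj e (y - y')‖ + |s| * ‖e‖ := by
          refine (norm_add_le _ _).trans ?_
          rw [norm_smul, Real.norm_eq_abs]
        _ ≤ ‖prj e (y - y')‖ + L * ‖prj e (y - y')‖ * ‖e‖ := by gcongr
        _ = (1 + L * ‖e‖) * ‖prj e (y - y')‖ := by ring
    · intro y hy
      simp only [mem_iUnion] at hy
      obtain ⟨u, ⟨⟨g, hg, rfl⟩, _⟩, hy⟩ := hy
      rw [hface g hg] at hy
      exact ⟨_, ⟨y, hPx g hg y hy, rfl⟩, rfl, g, hg, hy⟩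
  calc ENNReal.ofReal (n * τ1 * M ^ (p - 1)) * μH[(n : ℝ) - 1] P
      ≤ ENNReal.ofReal (n * τ1 * M ^ (p - 1)) *
        (ENNReal.ofReal (L + L ^ 2 * ‖e‖) ^ ((n : ℝ) - 1) * μH[(n : ℝ) - 1] ω) := by
        gcongr; exact s1.trans (by gcongr)
    _ = ENNReal.ofReal (L + L ^ 2 * ‖e‖) ^ ((n : ℝ) - 1) *
        (ENNReal.ofReal (n * τ1 * M ^ (p - 1)) * μH[(n : ℝ) - 1] ω) := by ring
    _ ≤ _ := mul_le_mul' le_rfl (s3.trans s4)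

theorem meas3 {n : ℕ} (hn : 2 ≤ n) {e : EE n} (he : e ≠ 0) {Cp : Set (EE n)} {M : ℝ}
    (hM : ∀ x ∈ Cp, ‖x‖ ≤ M) (hint : (interior Cp).Nonempty) :
    μH[(n : ℝ) - 1] (prj e '' Cp) ≠ 0 ∧ μH[(n : ℝ) - 1] (prj e '' Cp) ≠ ⊤ := by
  have hd : (0 : ℝ) ≤ (n : ℝ) - 1 := by
    have : (2 : ℝ) ≤ n := by exact_mod_cast hn
    linarith
  let W := (Submodule.span ℝ {e})ᗮ
  have hfin : ((Module.finrank ℝ W : ℕ) : ℝ) = (n : ℝ) - 1 := by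
    have h1 := Submodule.finrank_add_finrank_orthogonal (Submodule.span ℝ {e})
    rw [finrank_span_singleton he, finrank_euclideanSpace_fin] at h1
    have h2 : ((1 + Module.finrank ℝ W : ℕ) : ℝ) = n := by exact_mod_cast h1
    push_cast at h2
    linarith
  have hiso : Isometry (Subtype.val : W → EE n) := isometry_subtype_coe
  have hH : (μH[(n : ℝ) - 1] : Measure W).IsAddHaarMeasure := by
    rw [← hfin]; infer_instance
  constructor
  · obtain ⟨x, hx⟩ := hint
    obtain ⟨r, hr, hb⟩ := Metric.isOpen_iff.1 isOpen_interior x hx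
    have hsub : Subtype.val '' (Metric.ball (⟨prj e x, prj_mem e x⟩ : W) r) ⊆ prj e '' Cp := by
      rintro _ ⟨y, hy, rfl⟩
      refine ⟨x + (y.1 - prj e x), ?_, ?_⟩
      · apply interior_subset
        apply hb
        rw [mem_ball_iff_norm, add_sub_cancel_left]
        rw [mem_ball_iff_norm] at hy
        exact hy
      · rw [map_add, map_sub, prj_fix y.2, prj_fix (prj_mem e x)]; abel
    intro h
    have h1 := measure_mono_null hsub h
    rw [hiso.hausdorffMeasure_image (Or.inl hd)] at h1
    exact (Metric.measure_ball_pos (μH[(n : ℝ) - 1] : Measure W) _ hr).ne' h1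
  · have hsub : prj e '' Cp ⊆ Subtype.val '' (Metric.closedBall (0 : W) M) := by
      rintro _ ⟨x, hx, rfl⟩
      refine ⟨⟨prj e x, prj_mem e x⟩, ?_, rfl⟩
      rw [mem_closedBall_zero_iff]
      exact (prj_norm e x).trans (hM x hx)
    refine ne_top_of_le_ne_top ?_ (measure_mono hsub)
    rw [hiso.hausdorffMeasure_image (Or.inl hd)]
    exact measure_closedBall_lt_top.ne

theorem geoN {n : ℕ} {K : Set (EE n)} {x0 z x u : EE n} {r0 : ℝ} (hr0 : 0 < r0)
    (hball : Metric.closedBall x0 r0 ⊆ K) (hxz : ‖x - z‖ ≤ r0 / 2)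
    (hu : ∀ y ∈ K, ⟪u, y⟫ ≤ ⟪u, x⟫) : r0 / 2 * ‖u‖ ≤ ⟪u, z - x0⟫ := by
  by_cases h0 : u = 0
  · simp [h0]
  have hpos : 0 < ‖u‖ := norm_pos_iff.2 h0
  have h1 := hu (x0 + (r0 / ‖u‖) • u) (hball (by
    rw [mem_closedBall_iff_norm, add_sub_cancel_left, norm_smul, norm_div, norm_norm,
      Real.norm_of_nonneg hr0.le, div_mul_cancel₀ _ hpos.ne']))
  rw [inner_add_right, inner_smul_right, real_inner_self_eq_norm_sq] at h1
  have h2 : r0 / ‖u‖ * ‖u‖ ^ 2 = r0 * ‖u‖ := by field_simp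
  rw [h2] at h1
  have h3 := real_inner_le_norm u (x - z)
  rw [inner_sub_right] at h3 ⊢
  have h4 := mul_le_mul_of_nonneg_left hxz hpos.le
  nlinarith

theorem geoTop {n : ℕ} {K : Set (EE n)} (hK : IsCompact K) (hconv : Convex ℝ K)
    (hint : (interior K).Nonempty) {e x : EE n} (he : e ≠ 0) (hx : x ∈ K) :
    ∃ s : ℝ, 0 ≤ s ∧ x + s • e ∈ K ∧ ∃ u : EE n, u ≠ 0 ∧ ∀ y ∈ K, ⟪u, y⟫ ≤ ⟪u, x + s • e⟫ := by
  obtain ⟨M, hM⟩ := hK.isBounded.exists_norm_le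
  have hepos : 0 < ‖e‖ := norm_pos_iff.2 he
  set I : Set ℝ := {s | 0 ≤ s} ∩ (fun s : ℝ => x + s • e) ⁻¹' K with hI
  have hIc : IsClosed I := (isClosed_le continuous_const continuous_id).inter
    (hK.isClosed.preimage (by fun_prop))
  have hIb : I ⊆ Icc 0 (2 * M / ‖e‖) := by
    rintro s ⟨hs, hsK⟩
    refine ⟨hs, ?_⟩
    rw [le_div_iff₀ hepos]
    have h1 := norm_sub_le (x + s • e) x
    rw [add_sub_cancel_left, norm_smul, Real.norm_of_nonneg hs] at h1
    linarith [hM _ hsK, hM x hx]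
  have hIcomp : IsCompact I := isCompact_Icc.of_isClosed_subset hIc hIb
  obtain ⟨s, hs, hmax⟩ := hIcomp.exists_isMaxOn ⟨0, le_refl (0 : ℝ), by simpa using hx⟩
    (f := fun s => s) continuousOn_id
  refine ⟨s, hs.1, hs.2, ?_⟩
  have hnot : x + s • e ∉ interior K := by
    intro hin
    obtain ⟨r, hr, hb⟩ := Metric.isOpen_iff.1 isOpen_interior _ hin
    have h1 : s + r / (2 * ‖e‖) ∈ I := by
      have hq : 0 < r / (2 * ‖e‖) := by positivity
      refine ⟨add_nonneg hs.1 hq.le, ?_⟩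
      show x + (s + r / (2 * ‖e‖)) • e ∈ K
      refine interior_subset (hb ?_)
      rw [mem_ball_iff_norm]
      have : x + (s + r / (2 * ‖e‖)) • e - (x + s • e) = (r / (2 * ‖e‖)) • e := by module
      rw [this, norm_smul, Real.norm_of_nonneg hq.le]
      have : r / (2 * ‖e‖) * ‖e‖ = r / 2 := by field_simp
      linarith
    have h2 : s + r / (2 * ‖e‖) ≤ s := hmax h1
    have hq : 0 < r / (2 * ‖e‖) := by positivity
    linarith
  obtain ⟨f, hf⟩ := geometric_hahn_banach_open_point hconv.interior isOpen_interior hnot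
  refine ⟨(InnerProductSpace.toDual ℝ (EE n)).symm f, ?_, ?_⟩
  · intro h0
    have h1 : f = 0 := by simpa using h0
    obtain ⟨y, hy⟩ := hint
    have := hf y hy
    simp [h1] at this
  · intro y hy
    rw [InnerProductSpace.toDual_symm_apply, InnerProductSpace.toDual_symm_apply]
    have hcl : K ⊆ closure (interior K) := by
      rw [hconv.closure_interior_eq_closure_of_nonempty_interior hint]
      exact subset_closure
    have hclosed : IsClosed {w : EE n | f w ≤ f (x + s • e)} :=
      isClosed_le f.continuous continuous_const
    exact closure_minimal (fun w hw => (hf w hw).le) hclosed (hcl hy)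

/-- the cap of `K` cut off by `v, t` -/
def capS {n : ℕ} (K : Set (EE n)) (v : EE n) (t : ℝ) : Set (EE n) := {x ∈ K | t < ⟪v, x⟫}

theorem geoP {n : ℕ} {K : Set (EE n)} (hK : IsCompact K) (hconv : Convex ℝ K)
    {z v g : EE n} {t m : ℝ} (hz : z ∈ K) (hm : 0 < m) (hmz : ⟪v, z⟫ = t + m)
    (hg : ∀ y ∈ capS K v t, ⟪g, y - z⟫ ≤ m / 2) {x : EE n} (hx : x ∈ face K (v + g)) :
    x ∈ capS K v t := by
  rw [aux_mem_face hK] at hx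
  refine ⟨hx.1, ?_⟩
  by_contra hcon
  push Not at hcon
  have h1 := hx.2 z hz
  rw [inner_add_left, inner_add_left] at h1
  have hden : 0 < t + m - ⟪v, x⟫ := by linarith
  set τ : ℝ := 3 / 4 * m / (t + m - ⟪v, x⟫) with hτ
  have hτ0 : 0 < τ := by positivity
  have hτm : τ * (t + m - ⟪v, x⟫) = 3 / 4 * m := by rw [hτ]; field_simp
  have hτ1 : τ ≤ 1 := by rw [hτ, div_le_one hden]; linarith
  have hmem : z + τ • (x - z) ∈ capS K v t := by
    refine ⟨hconv.add_smul_sub_mem hz hx.1 ⟨hτ0.le, hτ1⟩, ?_⟩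
    rw [inner_add_right, inner_smul_right, inner_sub_right, hmz]
    nlinarith
  have h2 := hg _ hmem
  rw [add_sub_cancel_left, inner_smul_right, inner_sub_right] at h2
  have h3 : t + m - ⟪v, x⟫ ≤ ⟪g, x⟫ - ⟪g, z⟫ := by linarith
  have h4 := mul_le_mul_of_nonneg_left h3 hτ0.le
  linarith


theorem sc1 {κ m D : ℝ} (hκ : 0 < κ) (h4 : κ ≤ 1 / 4) (hm : 0 < m)
    (h : (1 - κ) * D ≤ (1 + κ) * m) : D ≤ 4 * m := by
  by_contra hcon
  push Not at hcon
  nlinarith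

theorem sc2 {κ t A B : ℝ} (hκ : 0 < κ) (h4 : κ ≤ 1 / 4) (hA : t < A) (hB : t < B) :
    t < (1 - κ) * A + κ * B := by nlinarith

theorem sc3 {κ m t X R : ℝ} (hκ : 0 < κ) (h4 : κ ≤ 1 / 4) (hm : 0 < m) (hX : t < X)
    (hR : R < -(5 * κ * m))
    (h : (1 - κ) * (-R) ≤ (1 + κ) * m - ((1 - κ) * (t + (1 - κ / 2) * m) + κ * X - t)) :
    False := by
  have h1 : (1 - κ) * (5 * κ * m) < (1 - κ) * (-R) :=
    mul_lt_mul_of_pos_left (by linarith) (by linarith)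
  have h2 : κ * t < κ * X := mul_lt_mul_of_pos_left hX hκ
  have h3 : 0 < κ * m := by positivity
  have h5 : κ * (κ * m) ≤ 1 / 4 * (κ * m) := mul_le_mul_of_nonneg_right h4 h3.le
  have h6 : 0 < κ * (κ * m) := by positivity
  nlinarith

theorem sc4 {κ A B D : ℝ} (h4 : κ ≤ 1 / 4) (hB : 0 ≤ B) (hAB : B * κ = A)
    (h : (1 - κ) * (-D) ≤ A) : -B ≤ D := by
  by_contra hcon
  push Not at hcon
  have := mul_lt_mul_of_pos_left (show B < -D by linarith) (show 0 < 1 - κ by linarith)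
  nlinarith

theorem sc5 {κ A D : ℝ} (hκ : 0 < κ) (h4 : κ ≤ 1 / 4) (hA : 0 ≤ A) (h : (1 - κ) * D ≤ A) :
    κ * D ≤ A := by
  by_cases h0 : D ≤ 0
  · nlinarith
  · push Not at h0; nlinarith

set_option maxHeartbeats 1000000 in
theorem geoG {n : ℕ} {K : Set (EE n)} (hK : IsCompact K) (hconv : Convex ℝ K)
    (hint : (interior K).Nonempty) {x0 z y1 v e c : EE n} {r0 t m M V κ : ℝ} (hr0 : 0 < r0)
    (hball : Metric.closedBall x0 r0 ⊆ K) (hM0 : 0 < M) (hM : ∀ x ∈ K, ‖x‖ ≤ M)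
    (he : e = z - x0) (hve : ⟪v, e⟫ = 1) (hV : ‖v‖ ≤ V) (hκ : 0 < κ) (hκ4 : κ ≤ 1 / 4)
    (hz : z ∈ K) (hy1 : y1 ∈ K) (hm : 0 < m) (hm4 : m ≤ 4) (hmz : ⟪v, z⟫ = t + m)
    (hmy : ⟪v, y1⟫ = t + m / 2)
    (hcap : ∀ x ∈ capS K v t, ‖x - z‖ ≤ r0 / 2 ∧ ⟪v, x⟫ - t ≤ (1 + κ) * m)
    (hc : c = z + κ • (y1 - z)) (hvc : 0 ≤ ⟪v, c⟫) :
    ∃ c' : EE n, ∀ x ∈ capS K v t, ∃ s : ℝ, ∃ p : EE n,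
      c' + κ • x + s • e ∈ face K (v + p) ∧ ⟪p, e⟫ = 0 ∧ ‖v + p‖ ≤ 2 / r0 ∧
      -(20 * κ / (r0 / (2 * M))) ≤ ⟪p, c⟫ ∧
      |⟪p, z - y1⟫| ≤ (4 + r0 * (2 / r0 + V) / 8) / κ * m ∧
      ∀ y ∈ capS K v t, ⟪p, y - z⟫ ≤ (4 + r0 * (2 / r0 + V) / 8) / κ * m := by
  set β : ℝ := r0 / (2 * M) with hβ
  have hβ0 : 0 < β := by positivity
  set s0 : ℝ := m / 4 with hs0
  have hs00 : 0 < s0 := by positivity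
  set r : ℝ := s0 * β with hr
  have hrpos : 0 < r := by positivity
  have hene : e ≠ 0 := by
    rintro rfl; simp at hve
  have hqc : ⟪v, c⟫ = t + (1 - κ / 2) * m := by
    rw [hc, inner_add_right, inner_smul_right, inner_sub_right, hmz, hmy]; ring
  have hcK : c ∈ K := by
    rw [hc]; exact hconv.add_smul_sub_mem hz hy1 ⟨hκ.le, by linarith⟩
  have hccap : c ∈ capS K v t := ⟨hcK, by rw [hqc]; nlinarith⟩
  have hzcap : z ∈ capS K v t := ⟨hz, by rw [hmz]; linarith⟩
  have hycap : y1 ∈ capS K v t := ⟨hy1, by rw [hmy]; linarith⟩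
  set ct : EE n := c - s0 • e + r • c with hct
  have hctK : ct ∈ K := by
    have h1 : x0 + ((c - z) + β • c) ∈ K := by
      apply hball
      rw [mem_closedBall_iff_norm, add_sub_cancel_left]
      refine (norm_add_le _ _).trans ?_
      rw [norm_smul, Real.norm_of_nonneg hβ0.le]
      have h2 := (hcap c hccap).1
      have h3 : β * ‖c‖ ≤ β * M := mul_le_mul_of_nonneg_left (hM c hcK) hβ0.le
      have h4 : β * M = r0 / 2 := by rw [hβ]; field_simp
      linarith
    have h2 : ct = c + s0 • (x0 + ((c - z) + β • c) - c) := by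
      rw [hct, he, hr]; module
    rw [h2]
    exact hconv.add_smul_sub_mem hcK h1 ⟨hs00.le, by linarith⟩
  have hqct : t + m / 2 ≤ ⟪v, ct⟫ := by
    rw [hct, inner_add_right, inner_sub_right, inner_smul_right, inner_smul_right, hve]
    have : 0 ≤ r * ⟪v, c⟫ := by positivity
    nlinarith
  refine ⟨(1 - κ) • ct, fun x hx => ?_⟩
  have hqx : t < ⟪v, x⟫ := hx.2
  set a : EE n := (1 - κ) • ct + κ • x with ha
  have haK : a ∈ K := hconv hctK hx.1 (by linarith) hκ.le (by ring)
  have hqa : ⟪v, a⟫ = (1 - κ) * ⟪v, ct⟫ + κ * ⟪v, x⟫ := by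
    rw [ha, inner_add_right, inner_smul_right, inner_smul_right]
  obtain ⟨s, hs, hsK, u, hu0, hu⟩ := geoTop hK hconv hint hene haK
  have hqs : ⟪v, a + s • e⟫ = ⟪v, a⟫ + s := by
    rw [inner_add_right, inner_smul_right, hve, mul_one]
  have hta : t < ⟪v, a⟫ := by
    rw [hqa]; exact sc2 hκ hκ4 (by linarith) hqx
  have hscap : a + s • e ∈ capS K v t := ⟨hsK, by rw [hqs]; linarith⟩
  obtain ⟨hs1, hs2⟩ := hcap _ hscap
  rw [hqs] at hs2
  have hN := geoN hr0 hball hs1 hu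
  rw [← he] at hN
  have hupos : 0 < ‖u‖ := norm_pos_iff.2 hu0
  have huepos : 0 < ⟪u, e⟫ := lt_of_lt_of_le (by positivity) hN
  set u' : EE n := (⟪u, e⟫)⁻¹ • u with hu'
  have hu'e : ⟪u', e⟫ = 1 := by
    rw [hu', inner_smul_left, RCLike.conj_to_real, inv_mul_cancel₀ huepos.ne']
  have hu'm : ∀ y ∈ K, ⟪u', y⟫ ≤ ⟪u', a + s • e⟫ := by
    intro y hy
    rw [hu', inner_smul_left, inner_smul_left, RCLike.conj_to_real]
    exact mul_le_mul_of_nonneg_left (hu y hy) (inv_pos.2 huepos).le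
  have hu'L : ‖u'‖ ≤ 2 / r0 := by
    have := geoN hr0 hball hs1 hu'm
    rw [← he, hu'e] at this
    rw [le_div_iff₀ hr0]; linarith
  set p : EE n := u' - v with hp
  have hvp : v + p = u' := by rw [hp]; abel
  have hpe : ⟪p, e⟫ = 0 := by rw [hp, inner_sub_left, hu'e, hve, sub_self]
  -- key inequality
  have key : ∀ y ∈ K, ⟪p, y - a⟫ ≤ (1 + κ) * m - (⟪v, y⟫ - t) := by
    intro y hy
    have h1 := hu'm y hy
    rw [← hvp, inner_add_right, inner_smul_right, inner_add_left, inner_add_left, inner_add_left,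
      hve, hpe] at h1
    rw [inner_sub_right]
    linarith
  have hpn : ‖p‖ ≤ 2 / r0 + V := (norm_sub_le _ _).trans (by linarith)
  have hpc : |⟪p, c⟫| ≤ (2 / r0 + V) * M := by
    refine (abs_real_inner_le_norm p c).trans ?_
    have := hM c hcK
    have h0 : 0 ≤ 2 / r0 + V := (norm_nonneg _).trans hpn
    gcongr
  set C5 : ℝ := 4 + r0 * (2 / r0 + V) / 8 with hC5
  have hC50 : 0 ≤ C5 := by
    have h0 : 0 ≤ 2 / r0 + V := (norm_nonneg _).trans hpn
    positivity
  have hrC : r * ⟪p, c⟫ ≤ (C5 - 4) * m := by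
    have h1 := mul_le_mul_of_nonneg_left (abs_le.1 hpc).2 hrpos.le
    have h2 : r * ((2 / r0 + V) * M) = (C5 - 4) * m := by
      rw [hr, hs0, hβ, hC5]; field_simp; ring
    linarith
  have h2c : ∀ y ∈ capS K v t, ⟪p, y - c⟫ ≤ C5 * m := by
    intro y hy
    have h1 := key ((1 - κ) • y + κ • x) (hconv hy.1 hx.1 (by linarith) hκ.le (by ring))
    have h2 : (1 - κ) • y + κ • x - a = (1 - κ) • (y - c - (r • c - s0 • e)) := by
      rw [ha, hct]; module
    have hty : t < ⟪v, y⟫ := hy.2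
    rw [h2, inner_smul_right, inner_sub_right, inner_sub_right p (r • c), inner_smul_right,
      inner_smul_right, hpe, inner_add_right, inner_smul_right, inner_smul_right] at h1
    have h3 : t ≤ (1 - κ) * ⟪v, y⟫ + κ * ⟪v, x⟫ := (sc2 hκ hκ4 hty hqx).le
    have h4 : (1 - κ) * (⟪p, y - c⟫ - r * ⟪p, c⟫) ≤ (1 + κ) * m := by linarith
    have h5 : ⟪p, y - c⟫ - r * ⟪p, c⟫ ≤ 4 * m := sc1 hκ hκ4 hm h4
    linarith
  have hzy : κ * ⟪p, z - y1⟫ ≤ C5 * m := by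
    have h1 := h2c z hzcap
    have h2 : z - c = κ • (z - y1) := by rw [hc]; module
    rwa [h2, inner_smul_right] at h1
  have hyz : (1 - κ) * ⟪p, y1 - z⟫ ≤ C5 * m := by
    have h1 := h2c y1 hycap
    have h2 : y1 - c = (1 - κ) • (y1 - z) := by rw [hc]; module
    rwa [h2, inner_smul_right] at h1
  have hneg : ⟪p, y1 - z⟫ = -⟪p, z - y1⟫ := by rw [← inner_neg_right, neg_sub]
  have hC5m : 0 ≤ C5 * m := by positivity
  have hdiv : C5 / κ * m = C5 * m / κ := by ring
  refine ⟨s, p, ?_, hpe, by rw [hvp]; exact hu'L, ?_, ?_, ?_⟩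
  · rw [hvp, aux_mem_face hK]
    exact ⟨hsK, hu'm⟩
  · have h1 := key ((1 - κ) • c + κ • x) (hconv hcK hx.1 (by linarith) hκ.le (by ring))
    have h2 : (1 - κ) • c + κ • x - a = (1 - κ) • (s0 • e - r • c) := by
      rw [ha, hct]; module
    rw [h2, inner_smul_right, inner_sub_right, inner_smul_right,
      inner_smul_right, hpe, inner_add_right, inner_smul_right, inner_smul_right, hqc] at h1
    by_contra hcon
    push Not at hcon
    have h3 : ⟪p, c⟫ * β < -(20 * κ) := by
      have := mul_lt_mul_of_pos_right hcon hβ0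
      have h4 : -(20 * κ / β) * β = -(20 * κ) := by field_simp
      linarith
    have h5 : r * ⟪p, c⟫ = m / 4 * (⟪p, c⟫ * β) := by rw [hr, hs0]; ring
    have h6 : r * ⟪p, c⟫ < -(5 * κ * m) := by
      have := mul_lt_mul_of_pos_left h3 hs00
      rw [hs0] at this
      rw [h5]; linarith
    rw [mul_zero, zero_sub] at h1
    exact sc3 hκ hκ4 hm hqx h6 h1
  · rw [hdiv, abs_le]
    have hk : C5 * m / κ * κ = C5 * m := by field_simp
    have h0 : 0 ≤ C5 * m / κ := by positivity
    constructor
    · rw [hneg] at hyz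
      exact sc4 hκ4 h0 hk hyz
    · rw [le_div_iff₀ hκ]; linarith
  · intro y hy
    have h1 := h2c y hy
    have h2 : y - z = (y - c) + κ • (y1 - z) := by rw [hc]; module
    rw [h2, inner_add_right, inner_smul_right]
    have h3 : κ * ⟪p, y1 - z⟫ ≤ C5 * m := sc5 hκ hκ4 hC5m hyz
    have h4 : 2 * (C5 * m) ≤ C5 / κ * m := by
      rw [hdiv, le_div_iff₀ hκ]
      have := mul_le_mul_of_nonneg_right hκ4 hC5m
      linarith
    linarith

theorem ennChain {A B lam N ad S G P : ℝ≥0∞} (hS0 : S ≠ 0) (hS : S ≠ ⊤) (h1 : S ≤ A * G)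
    (h2 : N * (ad * G) ≤ P) (h3 : lam * P ≤ B * S) : N * (lam * ad) ≤ A * B := by
  have h : N * (lam * ad) * S ≤ A * B * S := by
    calc N * (lam * ad) * S ≤ N * (lam * ad) * (A * G) := by gcongr
      _ = A * (lam * (N * (ad * G))) := by ring
      _ ≤ A * (lam * P) := by gcongr
      _ ≤ A * (B * S) := by gcongr
      _ = A * B * S := by ring
  exact (ENNReal.mul_le_mul_iff_left hS0 hS).1 h

theorem capIneq {n : ℕ} (hn : 2 ≤ n) {p τ1 τ2 : ℝ} (hp : p < 1) (hτ1 : 0 < τ1)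
    {f : EE n → ℝ} (hf : ∀ u ∈ unitSphere n, τ1 < f u ∧ f u < τ2)
    {K : Set (EE n)} (hK : IsCompact K) (hconv : Convex ℝ K) (h0K : (0 : EE n) ∈ K)
    (hint : (interior K).Nonempty) (hsol : IsLpSolution p f K)
    {x0 z y1 v e c l : EE n} {r0 t m M V κ C hz0 η δ : ℝ} (hr0 : 0 < r0)
    (hball : Metric.closedBall x0 r0 ⊆ K) (hM0 : 0 < M) (hM : ∀ x ∈ K, ‖x‖ ≤ M)
    (he : e = z - x0) (hve : ⟪v, e⟫ = 1) (hV0 : 0 ≤ V) (hV : ‖v‖ ≤ V)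
    (hκ : 0 < κ) (hκ4 : κ ≤ 1 / 4)
    (hz : z ∈ K) (hy1 : y1 ∈ K) (hm : 0 < m) (hm4 : m ≤ 4) (hmz : ⟪v, z⟫ = t + m)
    (hmy : ⟪v, y1⟫ = t + m / 2)
    (hcap : ∀ x ∈ capS K v t, ‖x - z‖ ≤ r0 / 2 ∧ ⟪v, x⟫ - t ≤ (1 + κ) * m)
    (hc : c = z + κ • (y1 - z)) (hzz : 0 < hz0) (hvc : 3 / 4 * hz0 ≤ ⟪v, c⟫)
    (hκz : 20 * κ / (r0 / (2 * M)) ≤ hz0 / 4)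
    (hC : C = (4 + r0 * (2 / r0 + V) / 8) / κ)
    (hle : ⟪l, e⟫ = 0) (hη : 0 < η) (hlx : ∀ x ∈ capS K v t, ⟪l, x - z⟫ ≤ η)
    (hlz : ⟪l, z - y1⟫ = δ / 2) {N : ℕ} (hN : 0 < N) (hηδ : 4 * η * N < δ) :
    (N : ℝ≥0∞) * (ENNReal.ofReal (n * τ1 * M ^ (p - 1)) *
      ENNReal.ofReal (1 / (4 * C)) ^ ((n : ℝ) - 1)) ≤
    (ENNReal.ofReal (1 / κ) ^ ((n : ℝ) - 1) *
      (ENNReal.ofReal (n * τ2 * (hz0 / 2 / (2 / r0)) ^ (p - 1)) *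
        (ENNReal.ofReal (2 * ‖e‖) ^ ((n : ℝ) - 1)))) *
    (ENNReal.ofReal (2 / r0 + (2 / r0) ^ 2 * ‖e‖) ^ ((n : ℝ) - 1) *
      (ENNReal.ofReal (1 + 2 / r0 * ‖e‖) ^ ((n : ℝ) - 1))) := by
  have hne : K.Nonempty := ⟨0, h0K⟩
  have hd : (0 : ℝ) ≤ (n : ℝ) - 1 := by
    have : (2 : ℝ) ≤ n := by exact_mod_cast hn
    linarith
  have hL0 : 0 < 2 / r0 := by positivity
  have hC0 : 0 < C := by rw [hC]; positivity
  have hene : e ≠ 0 := by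
    rintro rfl; simp at hve
  have hNr : (0 : ℝ) < N := by exact_mod_cast hN
  have hcK : c ∈ K := by
    rw [hc]; exact hconv.add_smul_sub_mem hz hy1 ⟨hκ.le, by linarith⟩
  set P : Set (EE n) := {g | ⟪g, e⟫ = 0} ∩ {g | ∀ y ∈ capS K v t, ⟪g, y - z⟫ ≤ m / 2} with hPdef
  set G : Set (EE n) := {g | ⟪g, e⟫ = 0} ∩ {g | |⟪g, z - y1⟫| ≤ C * m} ∩
    {g | ∀ y ∈ capS K v t, ⟪g, y - z⟫ ≤ C * m} ∩ {g | ‖v + g‖ ≤ 2 / r0} ∩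
    {g | hz0 / 2 ≤ suppFn K (v + g)} with hGdef
  have hPx : ∀ g ∈ P, ∀ x ∈ face K (v + g), x ∈ capS K v t := fun g hg x hx =>
    geoP hK hconv hz hm hmz hg.2 hx
  have hPL : ∀ g ∈ P, ‖v + g‖ ≤ 2 / r0 := by
    intro g hg
    obtain ⟨x, hx⟩ := aux_face_nonempty hK hne (v + g)
    have h1 := (hcap x (hPx g hg x hx)).1
    have h2 := geoN hr0 hball h1 ((aux_mem_face hK).1 hx).2
    rw [← he, inner_add_left, hve, hg.1] at h2
    rw [le_div_iff₀ hr0]; linarith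
  have hclosed1 : IsClosed {g : EE n | ⟪g, e⟫ = 0} :=
    isClosed_eq (by fun_prop) continuous_const
  have hclosedA : ∀ q : ℝ, IsClosed {g : EE n | ∀ y ∈ capS K v t, ⟪g, y - z⟫ ≤ q} := by
    intro q
    simp only [setOf_forall]
    exact isClosed_iInter fun y => isClosed_iInter fun _ =>
      isClosed_le (by fun_prop) continuous_const
  have hbdd : ∀ s : Set (EE n), (∀ g ∈ s, ‖v + g‖ ≤ 2 / r0) →
      s ⊆ Metric.closedBall (-v) (2 / r0) := by
    intro s hs g hg
    rw [mem_closedBall_iff_norm, sub_neg_eq_add, add_comm]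
    exact hs g hg
  have hPc : IsCompact P := (isCompact_closedBall (-v) (2 / r0)).of_isClosed_subset
    (hclosed1.inter (hclosedA _)) (hbdd _ hPL)
  have hGL : ∀ g ∈ G, ‖v + g‖ ≤ 2 / r0 := fun g hg => hg.1.2
  have hGc : IsCompact G := by
    refine (isCompact_closedBall (-v) (2 / r0)).of_isClosed_subset ?_ (hbdd _ hGL)
    refine (((hclosed1.inter ?_).inter (hclosedA _)).inter ?_).inter ?_
    · exact isClosed_le (by fun_prop) continuous_const
    · exact isClosed_le (by fun_prop) continuous_const
    · exact isClosed_le continuous_const ((aux_supp_cont hK hne).comp (by fun_prop))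
  obtain ⟨c', hc'⟩ := geoG hK hconv hint hr0 hball hM0 hM he hve hV hκ hκ4 hz hy1 hm hm4 hmz hmy
    hcap hc (by linarith)
  have hGx : ∀ x ∈ capS K v t, ∃ s : ℝ, ∃ g ∈ G, c' + κ • x + s • e ∈ face K (v + g) := by
    intro x hx
    obtain ⟨s, g, h1, h2, h3, h4, h5, h6⟩ := hc' x hx
    rw [← hC] at h5 h6
    refine ⟨s, g, ⟨⟨⟨⟨h2, h5⟩, h6⟩, h3⟩, ?_⟩, h1⟩
    have h7 := aux_le_supp hK (v + g) hcK
    rw [inner_add_left] at h7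
    show hz0 / 2 ≤ suppFn K (v + g)
    linarith
  have m1 := meas1 hn hp hτ1 hf hK hne hsol hve hGc (fun g hg => hg.1.1.1.1) hL0
    (show 0 < hz0 / 2 by linarith) hκ hGL (fun g hg => hg.2) c' hGx
  have m2 := meas2 hn hp hτ1 hf hK h0K hsol hM hve hPc (fun g hg => hg.1) hL0 hPL hPx
  have hcint : (interior (capS K v t)).Nonempty := by
    have hx0 : x0 ∈ interior K := by
      refine interior_mono hball ?_
      rw [interior_closedBall _ hr0.ne']
      exact Metric.mem_ball_self hr0
    set θ : ℝ := min (1 / 2) (m / 2) with hθ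
    have hθ0 : 0 < θ := by positivity
    have hθ1 : θ ≤ 1 / 2 := min_le_left _ _
    have hθ2 : θ ≤ m / 2 := min_le_right _ _
    refine ⟨(1 - θ) • z + θ • x0, ?_⟩
    have h1 : (1 - θ) • z + θ • x0 ∈ interior K :=
      hconv.combo_self_interior_mem_interior hz hx0 (by linarith) hθ0 (by ring)
    have h2 : t < ⟪v, (1 - θ) • z + θ • x0⟫ := by
      have : (1 - θ) • z + θ • x0 = z - θ • e := by rw [he]; module
      rw [this, inner_sub_right, inner_smul_right, hve, hmz]; linarith
    refine interior_maximal (t := interior K ∩ {x | t < ⟪v, x⟫}) ?_ ?_ ⟨h1, h2⟩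
    · rintro x ⟨hx, hx'⟩; exact ⟨interior_subset hx, hx'⟩
    · exact isOpen_interior.inter (isOpen_lt continuous_const (by fun_prop))
  obtain ⟨hS0, hS⟩ := meas3 hn hene (fun x (hx : x ∈ capS K v t) => hM x hx.1) hcint
  have hpk : (N : ℝ≥0∞) * (ENNReal.ofReal (1 / (4 * C)) ^ ((n : ℝ) - 1) * μH[(n : ℝ) - 1] G) ≤
      μH[(n : ℝ) - 1] P := by
    refine aux_pack hd hGc N (a := 1 / (4 * C)) (B := C * m) (by positivity)
      ((m / (4 * η * N)) • l) (z - y1) ?_ (fun g hg => hg.1.1.1.2) ?_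
    · intro g hg j hj
      refine ⟨?_, fun y hy => ?_⟩
      · show ⟪_, e⟫ = 0
        have : ⟪g, e⟫ = 0 := hg.1.1.1.1
        simp only [inner_add_left, real_inner_smul_left, this, hle, mul_zero, add_zero]
      · simp only [inner_add_left, real_inner_smul_left]
        have h1 : ⟪g, y - z⟫ ≤ C * m := hg.1.1.2 y hy
        have h2 := hlx y hy
        have h3 : 1 / (4 * C) * ⟪g, y - z⟫ ≤ m / 4 := by
          calc 1 / (4 * C) * ⟪g, y - z⟫ ≤ 1 / (4 * C) * (C * m) := by gcongr
            _ = m / 4 := by field_simp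
        have h4 : (j : ℝ) * (m / (4 * η * N) * ⟪l, y - z⟫) ≤ m / 4 := by
          have hjN : (j : ℝ) ≤ N := by exact_mod_cast hj.le
          calc (j : ℝ) * (m / (4 * η * N) * ⟪l, y - z⟫) ≤ (j : ℝ) * (m / (4 * η * N) * η) := by
                gcongr
            _ ≤ (N : ℝ) * (m / (4 * η * N) * η) := by gcongr
            _ = m / 4 := by field_simp
        linarith
    · rw [real_inner_smul_left, hlz]
      have h1 : 2 * (1 / (4 * C)) * (C * m) = m / 2 := by field_simp; norm_num
      rw [h1, div_mul_eq_mul_div, lt_div_iff₀ (by positivity)]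
      nlinarith
  refine ennChain hS0 hS ?_ hpk ?_
  · simpa only [mul_assoc] using m1
  · simpa only [mul_assoc] using m2

theorem epsAux {A B ε : ℝ} (hA : 0 ≤ A) (hB : 0 < B) (hε0 : 0 ≤ ε) (h : ε ≤ B / (A + 1)) :
    ε * A ≤ B := by
  rw [le_div_iff₀ (by linarith)] at h
  nlinarith

theorem coreF {n : ℕ} (hn : 2 ≤ n) {p τ1 τ2 : ℝ} (hp : p < 1) (hτ1 : 0 < τ1)
    {f : EE n → ℝ} (hf : ∀ u ∈ unitSphere n, τ1 < f u ∧ f u < τ2)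
    {K : Set (EE n)} (hK : IsCompact K) (hconv : Convex ℝ K) (h0K : (0 : EE n) ∈ K)
    (hint : (interior K).Nonempty) (hsol : IsLpSolution p f K)
    {x0 z y0 u e l : EE n} {r0 hz0 b : ℝ} (hr0 : 0 < r0)
    (hball : Metric.closedBall x0 r0 ⊆ K)
    (he : e = z - x0) (hue : ⟪u, e⟫ = 1) (hz : z ∈ K) (hu : ∀ x ∈ K, ⟪u, x - z⟫ ≤ 0)
    (huz : ⟪u, z⟫ = hz0) (hzz : 0 < hz0) (hle : ⟪l, e⟫ = 0)
    (hF : ∀ x ∈ K, ⟪u, x - z⟫ = 0 → 2 * ⟪l, x - z⟫ + ‖x - z‖ ^ 2 ≤ 0)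
    (hy0 : y0 ∈ K) (huy : ⟪u, y0 - z⟫ = 0) (hly : ⟪l, y0 - z⟫ = -b) (hb : 0 < b) : False := by
  obtain ⟨M', hM'⟩ := hK.isBounded.exists_norm_le
  set M : ℝ := max M' 1 with hMdef
  have hM0 : 0 < M := lt_of_lt_of_le one_pos (le_max_right _ _)
  have hM : ∀ x ∈ K, ‖x‖ ≤ M := fun x hx => (hM' x hx).trans (le_max_left _ _)
  set δ : ℝ := min b (r0 ^ 2 / 16) with hδ
  have hδ0 : 0 < δ := lt_min hb (by positivity)
  have hδb : δ ≤ b := min_le_left _ _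
  have hδr : δ ≤ r0 ^ 2 / 16 := min_le_right _ _
  set y1 : EE n := z + (δ / (2 * b)) • (y0 - z) with hy1d
  have hy1 : y1 ∈ K := by
    refine hconv.add_smul_sub_mem hz hy0 ⟨by positivity, ?_⟩
    rw [div_le_one (by positivity)]; linarith
  have huy1 : ⟪u, y1 - z⟫ = 0 := by
    rw [hy1d, add_sub_cancel_left, inner_smul_right, huy, mul_zero]
  have hly1 : ⟪l, y1 - z⟫ = -(δ / 2) := by
    rw [hy1d, add_sub_cancel_left, inner_smul_right, hly]; field_simp
  set V : ℝ := ‖u‖ + ‖l‖ with hVd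
  have hV0 : 0 ≤ V := by positivity
  set β : ℝ := r0 / (2 * M) with hβ
  have hβ0 : 0 < β := by positivity
  set κ : ℝ := min (1 / 4) (β * hz0 / 80) with hκd
  have hκ : 0 < κ := lt_min (by norm_num) (by positivity)
  have hκ4 : κ ≤ 1 / 4 := min_le_left _ _
  have hκz : 20 * κ / β ≤ hz0 / 4 := by
    have : κ ≤ β * hz0 / 80 := min_le_right _ _
    rw [div_le_iff₀ hβ0]; linarith
  set C : ℝ := (4 + r0 * (2 / r0 + V) / 8) / κ with hC
  have hC0 : 0 < C := by positivity
  set c : EE n := z + κ • (y1 - z) with hc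
  have hcK : c ∈ K := hconv.add_smul_sub_mem hz hy1 ⟨hκ.le, by linarith⟩
  have hd : (0 : ℝ) ≤ (n : ℝ) - 1 := by
    have : (2 : ℝ) ≤ n := by exact_mod_cast hn
    linarith
  have main : ∀ N : ℕ, 0 < N → (N : ℝ≥0∞) * (ENNReal.ofReal (n * τ1 * M ^ (p - 1)) *
      ENNReal.ofReal (1 / (4 * C)) ^ ((n : ℝ) - 1)) ≤
    (ENNReal.ofReal (1 / κ) ^ ((n : ℝ) - 1) *
      (ENNReal.ofReal (n * τ2 * (hz0 / 2 / (2 / r0)) ^ (p - 1)) *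
        (ENNReal.ofReal (2 * ‖e‖) ^ ((n : ℝ) - 1)))) *
    (ENNReal.ofReal (2 / r0 + (2 / r0) ^ 2 * ‖e‖) ^ ((n : ℝ) - 1) *
      (ENNReal.ofReal (1 + 2 / r0 * ‖e‖) ^ ((n : ℝ) - 1))) := by
    intro N hN
    have hNr : (0 : ℝ) < N := by exact_mod_cast hN
    obtain ⟨η, hη, hηκ, hηN⟩ : ∃ η : ℝ, 0 < η ∧ η ≤ δ * κ ∧ 4 * η * N < δ := by
      refine ⟨min (δ * κ) (δ / (8 * N)), lt_min (by positivity) (by positivity),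
        min_le_left _ _, ?_⟩
      have h1 : min (δ * κ) (δ / (8 * N)) ≤ δ / (8 * N) := min_le_right _ _
      rw [le_div_iff₀ (by positivity)] at h1
      linarith
    obtain ⟨ε0, hε0, hnear⟩ := aux_near_face hK hu
      (ψ := fun x => 2 * ⟪l, x - z⟫ + ‖x - z‖ ^ 2) (by fun_prop) hF
      (show 0 < 2 * η by linarith)
    obtain ⟨ε, hε, hε1, hεa, hεb, hεc⟩ : ∃ ε : ℝ, 0 < ε ∧ ε ≤ 1 ∧
        ε * (2 * M * ‖l‖ + δ) ≤ ε0 ∧ ε * δ ≤ 4 ∧ ε * (‖l‖ * M) ≤ hz0 / 4 := by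
      have hl := norm_nonneg l
      set ε : ℝ := min 1 (min (ε0 / ((2 * M * ‖l‖ + δ) + 1)) (min (4 / (δ + 1))
        (hz0 / 4 / (‖l‖ * M + 1)))) with hεd
      have e0 : 0 < ε := by
        refine lt_min one_pos (lt_min (by positivity) (lt_min (by positivity) (by positivity)))
      have e1 : ε ≤ 1 := min_le_left _ _
      have e2 : ε ≤ min (ε0 / ((2 * M * ‖l‖ + δ) + 1)) (min (4 / (δ + 1))
        (hz0 / 4 / (‖l‖ * M + 1))) := min_le_right _ _
      have e3 := e2.trans (min_le_left _ _)
      have e4 := e2.trans (min_le_right _ _)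
      have e5 := e4.trans (min_le_left _ _)
      have e6 := e4.trans (min_le_right _ _)
      exact ⟨ε, e0, e1, epsAux (by positivity) hε0 e0.le e3, epsAux hδ0.le (by norm_num) e0.le e5,
        epsAux (by positivity) (by positivity) e0.le e6⟩
    set m : ℝ := ε * δ with hm
    have hm0 : 0 < m := by positivity
    set v : EE n := u + ε • l with hv
    set t : ℝ := ⟪v, z⟫ - m with ht
    have hvx : ∀ x, ⟪v, x⟫ - t = ⟪u, x - z⟫ + ε * (⟪l, x - z⟫ + δ) := by
      intro x
      have : ⟪v, x⟫ - ⟪v, z⟫ = ⟪u, x - z⟫ + ε * ⟪l, x - z⟫ := by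
        rw [← inner_sub_right, hv, inner_add_left, real_inner_smul_left]
      rw [ht, hm]; linarith
    have hnl : ∀ x ∈ K, ⟪l, x - z⟫ ≤ 2 * M * ‖l‖ := by
      intro x hx
      have h1 := real_inner_le_norm l (x - z)
      have h2 : ‖x - z‖ ≤ 2 * M := (norm_sub_le _ _).trans (by linarith [hM x hx, hM z hz])
      have h3 := mul_le_mul_of_nonneg_left h2 (norm_nonneg l)
      linarith
    have hcapx : ∀ x ∈ capS K v t, -δ ≤ ⟪l, x - z⟫ ∧ 2 * ⟪l, x - z⟫ + ‖x - z‖ ^ 2 < 2 * η := by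
      intro x hx
      have h1 : t < ⟪v, x⟫ := hx.2
      have h2 := hvx x
      have h3 := hu x hx.1
      constructor
      · by_contra hcon
        push Not at hcon
        have : ε * (⟪l, x - z⟫ + δ) < 0 := mul_neg_of_pos_of_neg hε (by linarith)
        linarith
      · refine hnear x hx.1 ?_
        have h4 : ε * (⟪l, x - z⟫ + δ) ≤ ε * (2 * M * ‖l‖ + δ) :=
          mul_le_mul_of_nonneg_left (by linarith [hnl x hx.1]) hε.le
        linarith
    refine capIneq hn hp hτ1 hf hK hconv h0K hint hsol (z := z) (y1 := y1) (v := v) (c := c)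
      (l := l) (t := t) (m := m) (η := η) (δ := δ) (V := V) hr0 hball hM0 hM he ?_ hV0 ?_ hκ hκ4
      hz hy1 hm0 hεb ?_ ?_ ?_ hc hzz ?_ hκz hC hle hη ?_ ?_ hN hηN
    · rw [hv, inner_add_left, real_inner_smul_left, hle, hue, mul_zero, add_zero]
    · rw [hv]
      refine (norm_add_le _ _).trans ?_
      rw [norm_smul, Real.norm_of_nonneg hε.le]
      have := mul_le_mul_of_nonneg_right hε1 (norm_nonneg l)
      linarith
    · rw [ht]; ring
    · have := hvx y1
      rw [huy1, hly1] at this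
      rw [hm]; linarith
    · intro x hx
      obtain ⟨h1, h2⟩ := hcapx x hx
      have hδκ : δ * κ ≤ δ * (1 / 4) := mul_le_mul_of_nonneg_left hκ4 hδ0.le
      constructor
      · apply le_of_sq_le_sq _ (by positivity)
        have : (r0 / 2) ^ 2 = r0 ^ 2 / 4 := by ring
        rw [this]
        linarith
      · rw [hvx x]
        have h3 := hu x hx.1
        have h5 := sq_nonneg ‖x - z‖
        have h4 : ε * (⟪l, x - z⟫ + δ) ≤ ε * (δ * κ + δ) :=
          mul_le_mul_of_nonneg_left (by linarith) hε.le
        rw [hm]; linarith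
    · have h1 : ⟪u, c⟫ = hz0 := by
        rw [hc, inner_add_right, inner_smul_right, huy1, huz]; ring
      rw [hv, inner_add_left, real_inner_smul_left, h1]
      have h2 := (abs_le.1 (abs_real_inner_le_norm l c)).1
      have h3 := mul_le_mul_of_nonneg_left (hM c hcK) (norm_nonneg l)
      have h4 : ε * (-(‖l‖ * M)) ≤ ε * ⟪l, c⟫ := mul_le_mul_of_nonneg_left (by linarith) hε.le
      linarith
    · intro x hx
      have := (hcapx x hx).2
      have h5 := sq_nonneg ‖x - z‖
      linarith
    · rw [← neg_sub, inner_neg_right, hly1]; ring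
  have hn0 : (0 : ℝ) < n := by
    have : 0 < n := by omega
    exact_mod_cast this
  have hX : ENNReal.ofReal (n * τ1 * M ^ (p - 1)) *
      ENNReal.ofReal (1 / (4 * C)) ^ ((n : ℝ) - 1) ≠ 0 := by
    refine mul_ne_zero ?_ ?_
    · rw [Ne, ENNReal.ofReal_eq_zero, not_le]
      have := Real.rpow_pos_of_pos hM0 (p - 1)
      positivity
    · refine (ENNReal.rpow_pos ?_ ENNReal.ofReal_ne_top).ne'
      rw [ENNReal.ofReal_pos]; positivity
  have hY : (ENNReal.ofReal (1 / κ) ^ ((n : ℝ) - 1) *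
      (ENNReal.ofReal (n * τ2 * (hz0 / 2 / (2 / r0)) ^ (p - 1)) *
        (ENNReal.ofReal (2 * ‖e‖) ^ ((n : ℝ) - 1)))) *
    (ENNReal.ofReal (2 / r0 + (2 / r0) ^ 2 * ‖e‖) ^ ((n : ℝ) - 1) *
      (ENNReal.ofReal (1 + 2 / r0 * ‖e‖) ^ ((n : ℝ) - 1))) ≠ ⊤ := by
    have hr : ∀ q : ℝ, ENNReal.ofReal q ^ ((n : ℝ) - 1) ≠ ⊤ := fun q =>
      ENNReal.rpow_ne_top_of_nonneg hd ENNReal.ofReal_ne_top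
    exact ENNReal.mul_ne_top
      (ENNReal.mul_ne_top (hr _) (ENNReal.mul_ne_top ENNReal.ofReal_ne_top (hr _)))
      (ENNReal.mul_ne_top (hr _) (hr _))
  obtain ⟨N, hN⟩ := ENNReal.exists_nat_mul_gt hX hY
  rcases Nat.eq_zero_or_pos N with h | h
  · subst h
    simp at hN
  · exact absurd (main N h) (not_le.2 hN)

theorem faceSub {n : ℕ} (hn : 2 ≤ n) {p τ1 τ2 : ℝ} (hp : p < 1) (hτ1 : 0 < τ1)
    {f : EE n → ℝ} (hf : ∀ u ∈ unitSphere n, τ1 < f u ∧ f u < τ2)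
    {K : Set (EE n)} (hK : IsCompact K) (hconv : Convex ℝ K) (h0K : (0 : EE n) ∈ K)
    (hint : (interior K).Nonempty) (hsol : IsLpSolution p f K) {u0 y : EE n}
    (hyK : y ∈ K) (hy : 0 < ⟪u0, y⟫) {a a' : EE n} (ha : a ∈ face K u0) (ha' : a' ∈ face K u0) :
    a = a' := by
  by_contra hne
  have hFc : IsCompact (face K u0) := by
    have : face K u0 = K ∩ {x | ⟪x, u0⟫ = suppFn K u0} := rfl
    rw [this]
    exact hK.inter_right (isClosed_eq (by fun_prop) continuous_const)
  obtain ⟨z, hzF, hzmax⟩ := hFc.exists_isMaxOn ⟨a, ha⟩ (f := fun x => ‖x - a‖) (by fun_prop)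
  have hmax : ∀ x ∈ face K u0, ‖x - a‖ ≤ ‖z - a‖ := fun x hx => hzmax hx
  have hza : 0 < ‖z - a‖ := by
    refine lt_of_lt_of_le ?_ (hmax a' ha')
    rw [norm_pos_iff, sub_ne_zero]
    exact fun h => hne h.symm
  obtain ⟨x0, hx0⟩ := hint
  obtain ⟨r, hr, hb⟩ := Metric.isOpen_iff.1 isOpen_interior _ hx0
  have hball : Metric.closedBall x0 (r / 2) ⊆ K :=
    (Metric.closedBall_subset_ball (by linarith)).trans (hb.trans interior_subset)
  have hzK := ((aux_mem_face hK).1 hzF).1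
  have hzm := ((aux_mem_face hK).1 hzF).2
  have hu0 : 0 < ‖u0‖ := by
    rw [norm_pos_iff]; rintro rfl; simp at hy
  have hue := geoN (x := z) (z := z) (r0 := r / 2) (by linarith) hball
    (by simp; linarith) hzm
  set e : EE n := z - x0 with he
  have hue0 : 0 < ⟪u0, e⟫ := lt_of_lt_of_le (by positivity) hue
  set k : ℝ := (⟪u0, e⟫)⁻¹ with hk
  have hk0 : 0 < k := inv_pos.2 hue0
  set u : EE n := k • u0 with hu
  have hux : ∀ x, ⟪u, x⟫ = k * ⟪u0, x⟫ := fun x => by rw [hu, real_inner_smul_left]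
  set l : EE n := (z - a) - ⟪z - a, e⟫ • u with hl
  have hue1 : ⟪u, e⟫ = 1 := by rw [hux, hk, inv_mul_cancel₀ hue0.ne']
  have hlx : ∀ x, ⟪u, x⟫ = 0 → ⟪l, x⟫ = ⟪z - a, x⟫ := fun x hx => by
    rw [hl, inner_sub_left, real_inner_smul_left, hx, mul_zero, sub_zero]
  have haK := ((aux_mem_face hK).1 ha).1
  have ham := ((aux_mem_face hK).1 ha).2
  have hua : ⟪u, a - z⟫ = 0 := by
    rw [hux, inner_sub_right, le_antisymm (hzm a haK) (ham z hzK), sub_self, mul_zero]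
  refine coreF hn hp hτ1 hf hK hconv h0K ⟨x0, hx0⟩ hsol (x0 := x0) (z := z) (y0 := a) (u := u)
    (e := e) (l := l) (r0 := r / 2) (hz0 := ⟪u, z⟫) (b := ‖z - a‖ ^ 2) (by linarith) hball he hue1
    hzK ?_ rfl ?_ ?_ ?_ haK hua ?_ (by positivity)
  · intro x hx
    rw [hux, inner_sub_right]
    exact mul_nonpos_of_nonneg_of_nonpos hk0.le (by linarith [hzm x hx])
  · rw [hux]
    exact mul_pos hk0 (lt_of_lt_of_le hy (hzm y hyK))
  · rw [hl, inner_sub_left, real_inner_smul_left, hue1, mul_one, sub_self]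
  · intro x hx h0
    rw [hlx _ h0]
    have hxF : x ∈ face K u0 := by
      rw [aux_mem_face hK]
      refine ⟨hx, fun w hw => ?_⟩
      rw [hux, inner_sub_right] at h0
      have := (mul_eq_zero.1 h0).resolve_left hk0.ne'
      linarith [hzm w hw]
    have h1 := hmax x hxF
    have h2 : ‖x - a‖ ^ 2 = ‖z - a‖ ^ 2 + 2 * ⟪z - a, x - z⟫ + ‖x - z‖ ^ 2 := by
      rw [← norm_add_sq_real]
      congr 2
      abel
    have h3 : ‖x - a‖ ^ 2 ≤ ‖z - a‖ ^ 2 := by gcongr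
    linarith
  · rw [hlx _ hua, ← neg_sub z a, inner_neg_right, real_inner_self_eq_norm_sq]

/-- The support function of a solution of the `L_p` Minkowski problem is differentiable
at every `u₀ ∈ S^{n-1} \ N(K,o)`; equivalently, `F(K,u₀)` is a singleton there. -/
theorem stmt17 {n : ℕ} (hn : 2 ≤ n) {p : ℝ} (hp : p < 1) {τ1 τ2 : ℝ}
    (hτ1 : 0 < τ1) (hτ12 : τ1 < τ2) {f : EuclideanSpace ℝ (Fin n) → ℝ}
    (hf : ∀ u ∈ unitSphere n, τ1 < f u ∧ f u < τ2)
    {K : Set (EuclideanSpace ℝ (Fin n))} (hK : IsConvexBody0 K)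
    (hsol : IsLpSolution p f K) :
    ∀ u₀ ∈ unitSphere n \ normalCone K 0,
      DifferentiableAt ℝ (suppFn K) u₀ ∧ ∃ z, face K u₀ = {z} := by
  obtain ⟨hKc, hconv, hint, h0K⟩ := hK
  intro u₀ hu₀
  obtain ⟨y, hyK, hy⟩ : ∃ y ∈ K, 0 < ⟪u₀, y⟫ := by
    by_contra hcon
    push Not at hcon
    refine hu₀.2 fun y hy => ?_
    rw [inner_zero_right]
    exact hcon y hy
  obtain ⟨z, hz⟩ := aux_face_nonempty hKc ⟨0, h0K⟩ u₀
  have hF : face K u₀ = {z} := by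
    ext x
    refine ⟨fun hx => ?_, ?_⟩
    · exact faceSub hn hp hτ1 hf hKc hconv h0K hint hsol hyK hy hx hz
    · rintro rfl; exact hz
  exact ⟨aux_diff hKc hF, z, hF⟩
end
end
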